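/- arXiv:2312.06846 — 3 statements merged into one kernel-verified Lean document; each statement's English description precedes it below -/
import Mathlib

section
/- Let (R,m) be a Cohen-Macaulay Noetherian local ring of dimension d ≥ 1 and let I be an m-primary ideal. Set s = e_1(I) − e_0(I) + λ(R/I). Then for every n ≥ 0, λ(R/I^{n+1}) ≤ λ(R/I)·C(n+d,d) + (e_0(I) − λ(R/I) − 1)·C(n+d−1,d) + C(n−s−1+d,d), where C denotes the binomial coefficient and the last term is interpreted as 0 when n ≤ s. -/
open Finset IsLocalRing

/-- The length of an `R`-module `M`: the Krull dimension of its lattice of submodules,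
i.e. the supremum of the lengths of chains of submodules of `M`. -/
noncomputable def moduleLength (R M : Type*) [CommRing R] [AddCommGroup M] [Module R M] :
    WithBot ℕ∞ :=
  Order.krullDim (Submodule R M)

/-- A local Noetherian ring is Cohen-Macaulay if its depth equals its Krull dimension,
equivalently, if it admits a regular sequence in the maximal ideal whose length is the
Krull dimension. -/
def IsCohenMacaulayLocalRing (R : Type*) [CommRing R] [IsLocalRing R] : Prop :=
  ∃ rs : List R, (∀ x ∈ rs, x ∈ maximalIdeal R) ∧
    RingTheory.Sequence.IsRegular R rs ∧ (rs.length : WithBot ℕ∞) = ringKrullDim R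

/-- `e 0, …, e d` are the Hilbert coefficients of an ideal `I` in a ring of dimension `d`:
for all large `n`, `λ(R ⧸ I^(n+1)) = ∑_{i=0}^{d} (-1)^i (e i) C(n+d-i, d-i)`. -/
def HasHilbertCoeffs {R : Type*} [CommRing R] (I : Ideal R) (d : ℕ) (e : ℕ → ℤ) : Prop :=
  ∃ N : ℕ, ∀ n ≥ N, ∃ l : ℕ,
    moduleLength R (R ⧸ I ^ (n + 1)) = (l : WithBot ℕ∞) ∧
    (l : ℤ) = ∑ i ∈ Finset.range (d + 1), (-1 : ℤ) ^ i * e i * ((n + d - i).choose (d - i))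

theorem exists_notMem_of_isUnit_sub {R M : Type*} [CommRing R] [AddCommGroup M] [Module R M]
    (u : ℕ → R) (hu : ∀ i j, i ≠ j → IsUnit (u i - u j)) (𝒩 : Finset (Submodule R M))
    (h𝒩 : ∀ N ∈ 𝒩, N ≠ ⊤) : ∃ x : M, ∀ N ∈ 𝒩, x ∉ N := by
  classical
  induction 𝒩 using Finset.induction_on with
  | empty => exact ⟨0, by simp⟩
  | insert P 𝒩 _ ih =>
    obtain ⟨x, hx⟩ := ih fun N hN => h𝒩 N (Finset.mem_insert_of_mem hN)
    obtain ⟨y, -, hy⟩ := SetLike.exists_of_lt (lt_top_iff_ne_top.2 (h𝒩 P (by simp)))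
    by_contra! H
    choose f hf hf' using fun i => H (x + u i • y)
    obtain ⟨i, j, hij, hfij⟩ : ∃ i j, i ≠ j ∧ f i = f j := by
      obtain ⟨i, j, hij, h⟩ := Finite.exists_ne_map_eq_of_infinite
        fun i => (⟨f i, hf i⟩ : {N // N ∈ insert P 𝒩})
      exact ⟨i, j, hij, congrArg Subtype.val h⟩
    have h₁ := hf' i
    have h₂ := hf' j
    rw [← hfij] at h₂
    have hyf : y ∈ f i := by
      have h := (f i).sub_mem h₁ h₂
      rw [add_sub_add_left_eq_sub, ← sub_smul] at h
      exact (Submodule.smul_mem_iff_of_isUnit _ (hu i j hij)).1 h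
    have hxf : x ∈ f i := ((f i).add_mem_iff_left ((f i).smul_mem _ hyf)).1 h₁
    rcases Finset.mem_insert.1 (hf i) with h | h
    · exact hy (h ▸ hyf)
    · exact hx _ h hxf

/-- For a finite module over a Noetherian ring and an ideal `J` there are finitely many primes such
that multiplication by an element `y` outside those not containing `J` has `J`-power torsion
kernel. -/
theorem exists_primes_pow_smul_ker {A : Type*} [CommRing A] [IsNoetherianRing A] (J : Ideal A)
    {M : Type*} [AddCommGroup M] [Module A M] [Module.Finite A M] :
    ∃ 𝒬 : Finset (PrimeSpectrum A), ∀ y : A, (∀ P ∈ 𝒬, J ≤ P.asIdeal ∨ y ∉ P.asIdeal) →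
      ∃ c : ℕ, ∀ q : M, y • q = 0 → ∀ a ∈ J ^ c, a • q = 0 := by
  classical
  induction ‹Module.Finite A M› using
    IsNoetherianRing.induction_on_isQuotientEquivQuotientPrime A with
  | subsingleton N => exact ⟨∅, fun y _ => ⟨0, fun q _ a _ => Subsingleton.elim _ _⟩⟩
  | quotient N p f =>
    refine ⟨{p}, fun y hy => ⟨1, fun q hq a ha => ?_⟩⟩
    have hy := hy p (by simp)
    rw [pow_one] at ha
    apply f.injective
    replace hq := congrArg f hq
    rw [map_smul, map_zero] at hq ⊢
    obtain ⟨r, hr⟩ := Ideal.Quotient.mk_surjective (f q)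
    have key (b : A) : b • f q = 0 ↔ b * r ∈ p.asIdeal := by
      rw [← hr, ← Ideal.Quotient.eq_zero_iff_mem, map_mul]; rfl
    rw [key] at hq ⊢
    rcases hy with h | h
    · exact Ideal.mul_mem_right _ _ (h ha)
    · exact Ideal.mul_mem_left _ _ ((p.2.mem_or_mem hq).resolve_left h)
  | exact N₁ N₂ N₃ f g hf _ hfg h₁ h₃ =>
    obtain ⟨P₁, h₁⟩ := h₁
    obtain ⟨P₃, h₃⟩ := h₃
    refine ⟨P₁ ∪ P₃, fun y hy => ?_⟩
    obtain ⟨c₁, h₁⟩ := h₁ y fun P hP => hy P (Finset.mem_union_left _ hP)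
    obtain ⟨c₃, h₃⟩ := h₃ y fun P hP => hy P (Finset.mem_union_right _ hP)
    refine ⟨c₁ + c₃, fun q hq a ha => ?_⟩
    rw [pow_add] at ha
    induction ha using Submodule.mul_induction_on' with
    | mem_mul_mem a ha b hb =>
      have hb0 : g (b • q) = 0 := by
        rw [map_smul]
        exact h₃ _ (by rw [← map_smul, hq, map_zero]) b hb
      obtain ⟨q', hq'⟩ := (hfg _).1 hb0
      rw [mul_smul, ← hq', ← map_smul, h₁ q' (hf ?_) a ha, map_zero]
      rw [map_smul, hq', smul_comm, hq, smul_zero, map_zero]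
    | add a _ b _ ha hb => rw [add_smul, ha, hb, add_zero]

theorem exists_primes_isSMulRegular {R : Type*} [CommRing R] [IsNoetherianRing R] (J : Ideal R)
    {M : Type*} [AddCommGroup M] [Module R M] [Module.Finite R M] {r : R} (hr : r ∈ J)
    (hrM : IsSMulRegular M r) :
    ∃ 𝒬 : Finset (PrimeSpectrum R), ∀ y : R, (∀ P ∈ 𝒬, J ≤ P.asIdeal ∨ y ∉ P.asIdeal) →
      IsSMulRegular M y := by
  obtain ⟨𝒬, h𝒬⟩ := exists_primes_pow_smul_ker J (M := M)
  refine ⟨𝒬, fun y hy => ?_⟩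
  obtain ⟨c, hc⟩ := h𝒬 y hy
  refine (isSMulRegular_iff_right_eq_zero_of_smul).2 fun q hq => ?_
  exact (hrM.pow c).right_eq_zero_of_smul (hc q hq _ (Ideal.pow_mem_pow hr c))

theorem exists_primes_mem_of_smul_mem {A V : Type*} [CommRing A] [IsNoetherianRing A] (J : Ideal A)
    [AddCommGroup V] [Module A V] (N N' : Submodule A V) (hN : N.FG) :
    ∃ 𝒬 : Finset (PrimeSpectrum A), ∀ y : A, (∀ P ∈ 𝒬, J ≤ P.asIdeal ∨ y ∉ P.asIdeal) →
      ∃ c : ℕ, ∀ n ≥ c, ∀ z ∈ J ^ n • N, y • z ∈ N' → z ∈ N' := by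
  have : Module.Finite A N := Module.Finite.iff_fg.2 hN
  have : Module.Finite A (N.map N'.mkQ) := Module.Finite.iff_fg.2 (hN.map _)
  obtain ⟨𝒬, h𝒬⟩ := exists_primes_pow_smul_ker J (M := N.map N'.mkQ)
  refine ⟨𝒬, fun y hy => ?_⟩
  obtain ⟨c, hc⟩ := h𝒬 y hy
  let K : Submodule A (N.map N'.mkQ) :=
    LinearMap.ker (LinearMap.lsmul A (N.map N'.mkQ) y)
  obtain ⟨k, hk⟩ := J.exists_pow_inf_eq_pow_smul K
  refine ⟨c + k, fun n hn z hz hyz => ?_⟩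
  have hmap : N'.mkQ z ∈ J ^ n • N.map N'.mkQ := by
    rw [← Submodule.map_smul'']
    exact Submodule.mem_map_of_mem hz
  have hzN : N'.mkQ z ∈ N.map N'.mkQ := Submodule.smul_le_right hmap
  have hmem : (⟨_, hzN⟩ : N.map N'.mkQ) ∈ J ^ n • (⊤ : Submodule A (N.map N'.mkQ)) := by
    rw [← (N.map N'.mkQ).range_subtype, ← Submodule.map_top, ← Submodule.map_smul''] at hmap
    obtain ⟨w, hw, hw'⟩ := hmap
    convert! hw
    exact hw'.symm
  have hker : (⟨_, hzN⟩ : N.map N'.mkQ) ∈ K := by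
    refine Subtype.ext ?_
    change y • N'.mkQ z = 0
    rwa [← map_smul, Submodule.mkQ_apply, Submodule.Quotient.mk_eq_zero]
  have h0 : (⟨_, hzN⟩ : N.map N'.mkQ) = 0 := by
    have h : (⟨_, hzN⟩ : N.map N'.mkQ) ∈ J ^ (n - k) • K :=
      Submodule.smul_mono le_rfl inf_le_right ((hk n (by omega)).le ⟨hmem, hker⟩)
    generalize (⟨_, hzN⟩ : N.map N'.mkQ) = w at h
    induction h using Submodule.smul_induction_on' with
    | smul a ha q hq => exact hc q hq a (Ideal.pow_le_pow_right (by omega) ha)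
    | add _ _ _ _ h₁ h₂ => rw [h₁, h₂, add_zero]
  exact (Submodule.Quotient.mk_eq_zero _).1 (congrArg Subtype.val h0)

open RingTheory.Sequence in
/-- `M` admits a weakly regular sequence of length `d` inside `J`. -/
def HasWeaklyRegularSeq {R : Type*} [CommRing R] (J : Ideal R) (d : ℕ) (M : Type*)
    [AddCommGroup M] [Module R M] : Prop :=
  ∃ rs : List R, rs.length = d ∧ (∀ r ∈ rs, r ∈ J) ∧ IsWeaklyRegular M rs

namespace HasWeaklyRegularSeq

open scoped Pointwise

variable {R : Type*} [CommRing R] {J : Ideal R}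

theorem congr {d : ℕ} {M N : Type*} [AddCommGroup M] [Module R M] [AddCommGroup N] [Module R N]
    (e : M ≃ₗ[R] N) (h : HasWeaklyRegularSeq J d M) : HasWeaklyRegularSeq J d N := by
  obtain ⟨rs, hl, hJ, hrs⟩ := h
  exact ⟨rs, hl, hJ, (e.isWeaklyRegular_congr rs).1 hrs⟩

theorem succ_iff {d : ℕ} {M : Type*} [AddCommGroup M] [Module R M] :
    HasWeaklyRegularSeq J (d + 1) M ↔
      ∃ r ∈ J, IsSMulRegular M r ∧ HasWeaklyRegularSeq J d (QuotSMulTop r M) := by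
  constructor
  · rintro ⟨rs, hl, hJ, hrs⟩
    obtain ⟨r, rs, rfl⟩ := List.exists_cons_of_length_eq_add_one hl
    rw [RingTheory.Sequence.isWeaklyRegular_cons_iff] at hrs
    exact ⟨r, hJ r (by simp), hrs.1, rs, by simpa using hl, fun x hx => hJ x (by simp [hx]), hrs.2⟩
  · rintro ⟨r, hr, hrM, rs, hl, hJ, hrs⟩
    refine ⟨r :: rs, by simp [hl], ?_, ?_⟩
    · simpa [hr] using hJ
    · exact (RingTheory.Sequence.isWeaklyRegular_cons_iff _ _ _).2 ⟨hrM, hrs⟩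

/-- The two iterated quotients by `x` and `y` agree. -/
noncomputable def quotSMulTopComm (M : Type*) [AddCommGroup M] [Module R M] (x y : R) :
    QuotSMulTop x (QuotSMulTop y M) ≃ₗ[R] QuotSMulTop y (QuotSMulTop x M) :=
  Submodule.quotEquivOfEq _ _ (by
      rw [Submodule.map_pointwise_smul, Submodule.map_top, Submodule.range_mkQ]) ≪≫ₗ
    Submodule.quotientQuotientEquivQuotientSup (y • (⊤ : Submodule R M)) (x • ⊤) ≪≫ₗ
    Submodule.quotEquivOfEq _ _ (sup_comm _ _) ≪≫ₗ
    (Submodule.quotientQuotientEquivQuotientSup (x • (⊤ : Submodule R M)) (y • ⊤)).symm ≪≫ₗ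
    Submodule.quotEquivOfEq _ _ (by
      rw [Submodule.map_pointwise_smul, Submodule.map_top, Submodule.range_mkQ])

theorem _root_.IsSMulRegular.quotSMulTop_swap {M : Type*} [AddCommGroup M] [Module R M] {x r : R}
    (hr : IsSMulRegular M r) (hx : IsSMulRegular (QuotSMulTop r M) x) :
    IsSMulRegular (QuotSMulTop x M) r := by
  rw [isSMulRegular_iff_right_eq_zero_of_smul] at hx ⊢
  intro q hq
  obtain ⟨z, rfl⟩ := Submodule.mkQ_surjective _ q
  rw [← map_smul, Submodule.mkQ_apply, Submodule.Quotient.mk_eq_zero] at hq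
  obtain ⟨w, -, hw⟩ := (Submodule.mem_smul_pointwise_iff_exists _ _ _).1 hq
  have hw0 : Submodule.mkQ (r • (⊤ : Submodule R M)) w = 0 := by
    refine hx _ ?_
    rw [← map_smul, hw, Submodule.mkQ_apply, Submodule.Quotient.mk_eq_zero]
    exact Submodule.smul_mem_pointwise_smul _ _ _ trivial
  rw [Submodule.mkQ_apply, Submodule.Quotient.mk_eq_zero] at hw0
  obtain ⟨u, -, rfl⟩ := (Submodule.mem_smul_pointwise_iff_exists _ _ _).1 hw0
  rw [smul_comm] at hw
  rw [Submodule.mkQ_apply, Submodule.Quotient.mk_eq_zero, ← hr hw]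
  exact Submodule.smul_mem_pointwise_smul _ _ _ trivial

/-- An element avoiding finitely many primes can serve as the first term of a weakly regular
sequence of the given length. -/
theorem exists_primes [IsNoetherianRing R] (d : ℕ) {M : Type*} [AddCommGroup M] [Module R M]
    [Module.Finite R M] (h : HasWeaklyRegularSeq J (d + 1) M) :
    ∃ 𝒬 : Finset (PrimeSpectrum R), ∀ y ∈ J, (∀ P ∈ 𝒬, J ≤ P.asIdeal ∨ y ∉ P.asIdeal) →
      IsSMulRegular M y ∧ HasWeaklyRegularSeq J d (QuotSMulTop y M) := by
  classical
  induction d generalizing M with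
  | zero =>
    obtain ⟨r, hr, hrM, -⟩ := succ_iff.1 h
    obtain ⟨𝒬, h𝒬⟩ := exists_primes_isSMulRegular J hr hrM
    exact ⟨𝒬, fun y _ hy => ⟨h𝒬 y hy, [], rfl, by simp, .nil R _⟩⟩
  | succ d ih =>
    obtain ⟨r, hr, hrM, hd⟩ := succ_iff.1 h
    obtain ⟨𝒬, h𝒬⟩ := exists_primes_isSMulRegular J hr hrM
    obtain ⟨𝒬', h𝒬'⟩ := ih hd
    refine ⟨𝒬 ∪ 𝒬', fun y hyJ hy => ?_⟩
    obtain ⟨hy₁, hy₂⟩ := h𝒬' y hyJ fun P hP => hy P (Finset.mem_union_right _ hP)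
    exact ⟨h𝒬 y fun P hP => hy P (Finset.mem_union_left _ hP),
      succ_iff.2 ⟨r, hr, hrM.quotSMulTop_swap hy₁, hy₂.congr (quotSMulTopComm M y r)⟩⟩

end HasWeaklyRegularSeq

section Superficial

variable {R : Type*} [CommRing R] (I : Ideal R)

/-- The element `x t` of the Rees algebra `R[It]`. -/
noncomputable def reesDegreeOne : I →ₗ[R] reesAlgebra I where
  toFun x := ⟨Polynomial.monomial 1 (x : R), reesAlgebra.monomial_mem.2 (by simp)⟩
  map_add' x y := Subtype.ext (by simp)
  map_smul' r x := Subtype.ext (by simp [Polynomial.smul_monomial])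

/-- The irrelevant ideal of the Rees algebra. -/
noncomputable def reesIrrelevant : Ideal (reesAlgebra I) :=
  Ideal.span (Set.range (reesDegreeOne I))

variable {I}

theorem monomial_mem_reesIrrelevant_pow (n : ℕ) {a : R} (ha : a ∈ I ^ n) :
    (⟨Polynomial.monomial n a, reesAlgebra.monomial_mem.2 ha⟩ : reesAlgebra I) ∈
      reesIrrelevant I ^ n := by
  induction n generalizing a with
  | zero => simp
  | succ n ih =>
    have ha' := ha
    rw [pow_succ'] at ha'
    induction ha' using Submodule.mul_induction_on' with
    | mem_mul_mem x hx y hy =>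
      rw [pow_succ']
      convert! Ideal.mul_mem_mul
        (Ideal.subset_span ⟨⟨x, hx⟩, rfl⟩ : reesDegreeOne I ⟨x, hx⟩ ∈ reesIrrelevant I) (ih hy)
      simp [reesDegreeOne, Polynomial.monomial_mul_monomial, add_comm]
    | add x hx y hy h₁ h₂ =>
      rw [← pow_succ'] at hx hy
      convert! Ideal.add_mem _ (h₁ hx) (h₂ hy)
      simp

theorem single_mem_reesIrrelevant_pow_smul {M : Type*} [AddCommGroup M] [Module R M] (n : ℕ) {z : M}
    (hz : z ∈ I ^ n • (⊤ : Submodule R M)) :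
    PolynomialModule.single R n z ∈
      reesIrrelevant I ^ n • (I.stableFiltration (⊤ : Submodule R M)).submodule := by
  induction hz using Submodule.smul_induction_on' with
  | smul a ha m _ =>
    have : PolynomialModule.single R n (a • m) =
        (⟨Polynomial.monomial n a, reesAlgebra.monomial_mem.2 ha⟩ : reesAlgebra I) •
          PolynomialModule.single R 0 m := by
      rw [Subalgebra.smul_def, PolynomialModule.monomial_smul_single, add_zero]
    rw [this]
    refine Submodule.smul_mem_smul (monomial_mem_reesIrrelevant_pow n ha) fun i => ?_
    rw [PolynomialModule.coeff_single, Finsupp.single_apply]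
    split_ifs with h
    · subst h; simp
    · exact Submodule.zero_mem _
  | add x _ y _ hx hy =>
    rw [PolynomialModule.single_add]
    exact Submodule.add_mem _ hx hy

/-- The filtration `n ↦ I ^ (n + 1) • ⊤`. -/
def shiftedFiltration (I : Ideal R) (M : Type*) [AddCommGroup M] [Module R M] :
    I.Filtration M where
  N n := I ^ (n + 1) • ⊤
  mono n := Submodule.smul_mono_left (Ideal.pow_le_pow_right (by omega))
  smul_le n := by rw [← Submodule.mul_smul, ← pow_succ']

theorem exists_primes_superficial [IsNoetherianRing R] (I : Ideal R) (M : Type*) [AddCommGroup M]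
    [Module R M] [Module.Finite R M] :
    ∃ 𝒬 : Finset (PrimeSpectrum (reesAlgebra I)), ∀ x : I,
      (∀ P ∈ 𝒬, reesIrrelevant I ≤ P.asIdeal ∨ reesDegreeOne I x ∉ P.asIdeal) →
      ∃ c : ℕ, ∀ n ≥ c, ∀ z ∈ I ^ n • (⊤ : Submodule R M),
        (x : R) • z ∈ I ^ (n + 2) • (⊤ : Submodule R M) → z ∈ I ^ (n + 1) • (⊤ : Submodule R M) := by
  obtain ⟨𝒬, h𝒬⟩ := exists_primes_mem_of_smul_mem (reesIrrelevant I)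
    (I.stableFiltration (⊤ : Submodule R M)).submodule (shiftedFiltration I M).submodule
    ((Ideal.Filtration.submodule_fg_iff_stable _ fun i => IsNoetherian.noetherian _).2
      (I.stableFiltration_stable ⊤))
  refine ⟨𝒬, fun x hx => ?_⟩
  obtain ⟨c, hc⟩ := h𝒬 _ hx
  refine ⟨c, fun n hn z hz hxz => ?_⟩
  have h0 := hc n hn _ (single_mem_reesIrrelevant_pow_smul n hz) fun i => by
    change ((Polynomial.monomial 1 (x : R)) • PolynomialModule.single R n z).coeff i ∈ _
    rw [PolynomialModule.monomial_smul_single, PolynomialModule.coeff_single, Finsupp.single_apply]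
    split_ifs with h
    · subst h
      change _ ∈ I ^ (1 + n + 1) • ⊤
      rwa [add_comm 1 n]
    · exact Submodule.zero_mem _
  have := h0 n
  rwa [PolynomialModule.coeff_single, Finsupp.single_eq_same] at this

/-- Colon ideals by a suitably general element `x ∈ I` shift the `I`-adic filtration by one in large
degrees. -/
theorem exists_superficial [IsNoetherianRing R] (u : ℕ → R)
    (hu : ∀ i j, i ≠ j → IsUnit (u i - u j)) {J : Ideal R} (hIJ : I ≤ J) {k : ℕ} (hJI : J ^ k ≤ I)
    {d : ℕ} {M : Type*} [AddCommGroup M] [Module R M] [Module.Finite R M]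
    (hM : HasWeaklyRegularSeq J (d + 1) M) :
    ∃ x ∈ I, IsSMulRegular M x ∧ HasWeaklyRegularSeq J d (QuotSMulTop x M) ∧
      ∃ c : ℕ, ∀ n ≥ c, ∀ z : M, x • z ∈ I ^ (n + 1) • (⊤ : Submodule R M) →
        z ∈ I ^ n • (⊤ : Submodule R M) := by
  classical
  obtain ⟨𝒬₁, h₁⟩ := hM.exists_primes
  obtain ⟨𝒬₂, h₂⟩ := exists_primes_superficial I M
  obtain ⟨x, hx⟩ := exists_notMem_of_isUnit_sub (M := I) u hu
    (((𝒬₁.filter fun P => ¬ J ≤ P.asIdeal).image fun P => Submodule.comap I.subtype P.asIdeal) ∪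
      ((𝒬₂.filter fun P => ¬ reesIrrelevant I ≤ P.asIdeal).image
        fun P => Submodule.comap (reesDegreeOne I) (P.asIdeal.restrictScalars R))) (by
    intro N hN hNtop
    simp only [Finset.mem_union, Finset.mem_image, Finset.mem_filter] at hN
    obtain ⟨P, ⟨-, hP⟩, rfl⟩ | ⟨P, ⟨-, hP⟩, rfl⟩ := hN
    · refine hP (P.2.le_of_pow_le (n := k) (hJI.trans fun y hy => ?_))
      exact (hNtop.ge trivial : (⟨y, hy⟩ : I) ∈ _)
    · refine hP (Ideal.span_le.2 ?_)
      rintro _ ⟨y, rfl⟩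
      exact (hNtop.ge trivial : y ∈ _))
  have hx₁ : ∀ P ∈ 𝒬₁, J ≤ P.asIdeal ∨ (x : R) ∉ P.asIdeal := fun P hP =>
    or_iff_not_imp_left.2 fun hJ => hx _ (Finset.mem_union_left _
      (Finset.mem_image_of_mem (fun P : PrimeSpectrum R => Submodule.comap I.subtype P.asIdeal)
        (Finset.mem_filter.2 ⟨hP, hJ⟩)))
  have hx₂ : ∀ P ∈ 𝒬₂, reesIrrelevant I ≤ P.asIdeal ∨ reesDegreeOne I x ∉ P.asIdeal := fun P hP =>
    or_iff_not_imp_left.2 fun hJ => hx _ (Finset.mem_union_right _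
      (Finset.mem_image_of_mem (fun P : PrimeSpectrum (reesAlgebra I) =>
        Submodule.comap (reesDegreeOne I) (P.asIdeal.restrictScalars R))
        (Finset.mem_filter.2 ⟨hP, hJ⟩)))
  obtain ⟨hreg, hseq⟩ := h₁ x (hIJ x.2) hx₁
  obtain ⟨c, hc⟩ := h₂ x hx₂
  obtain ⟨k, hk⟩ := I.exists_pow_inf_eq_pow_smul
    (LinearMap.range (LinearMap.lsmul R M (x : R)))
  refine ⟨x, x.2, hreg, hseq, c + k, fun n hn z hz => ?_⟩
  have hstart : z ∈ I ^ (n + 1 - k) • (⊤ : Submodule R M) := by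
    have h : (x : R) • z ∈ I ^ (n + 1 - k) • LinearMap.range (LinearMap.lsmul R M (x : R)) :=
      Submodule.smul_mono le_rfl inf_le_right ((hk (n + 1) (by omega)).le ⟨hz, z, rfl⟩)
    rw [← Submodule.map_top, ← Submodule.map_smul''] at h
    obtain ⟨w, hw, hwz⟩ := h
    rwa [← hreg hwz]
  have climb : ∀ j, c ≤ j → j ≤ n → z ∈ I ^ j • (⊤ : Submodule R M) →
      z ∈ I ^ n • (⊤ : Submodule R M) := by
    intro j hj hjn
    induction hjn using Nat.decreasingInduction with
    | self => exact id
    | of_succ j hjn ih =>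
      intro h
      refine ih (by omega) (hc j hj z h ?_)
      exact Submodule.smul_mono_left (Ideal.pow_le_pow_right (by omega)) hz
  by_cases hk0 : k = 0
  · subst hk0
    exact Submodule.smul_mono_left (Ideal.pow_le_pow_right (by omega)) hstart
  · exact climb _ (by omega) (by omega) hstart

end Superficial

section Length

variable {R M : Type*} [CommRing R] [AddCommGroup M] [Module R M]

theorem isFiniteLength_quotient_smul_top [IsNoetherianRing R] [IsLocalRing R] {I : Ideal R} {k : ℕ}
    (hI : IsLocalRing.maximalIdeal R ^ k ≤ I) [Module.Finite R M] :
    IsFiniteLength R (M ⧸ I • (⊤ : Submodule R M)) := by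
  rcases eq_or_ne I ⊤ with rfl | hne
  · have : Subsingleton (M ⧸ (⊤ : Ideal R) • (⊤ : Submodule R M)) := by
      rw [Submodule.top_smul]; infer_instance
    exact .of_subsingleton
  have : Nontrivial (R ⧸ I) := Ideal.Quotient.nontrivial_iff.2 hne
  have : IsLocalRing (R ⧸ I) := .of_surjective' _ Ideal.Quotient.mk_surjective
  have : IsArtinianRing (R ⧸ I) := by
    rw [isArtinianRing_iff_isNilpotent_maximalIdeal]
    refine ⟨k, ?_⟩
    rw [← IsLocalRing.map_maximalIdeal_of_surjective _ Ideal.Quotient.mk_surjective,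
      ← Ideal.map_pow, Ideal.zero_eq_bot, Ideal.map_eq_bot_iff_le_ker, Ideal.mk_ker]
    exact hI
  have : Module.Finite (R ⧸ I) (M ⧸ I • (⊤ : Submodule R M)) :=
    Module.Finite.of_restrictScalars_finite R _ _
  rw [isFiniteLength_iff_isNoetherian_isArtinian]
  refine ⟨inferInstance, ?_⟩
  exact isArtinian_of_surjective_algebraMap (R := R ⧸ I) Ideal.Quotient.mk_surjective

theorem length_quotient_add_length_ker_mapQ (f : M →ₗ[R] M) (A B : Submodule R M)
    (h : A ≤ B.comap f) :
    Module.length R (M ⧸ B) + Module.length R (LinearMap.ker (A.mapQ B f h)) =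
      Module.length R (M ⧸ A) + Module.length R (M ⧸ (LinearMap.range f ⊔ B)) := by
  set g := A.mapQ B f h
  have h₁ : Module.length R (M ⧸ A) =
      Module.length R (LinearMap.ker g) + Module.length R (LinearMap.range g) :=
    Module.length_eq_add_of_exact (LinearMap.ker g).subtype g.rangeRestrict
      (Submodule.subtype_injective _) g.surjective_rangeRestrict
      (fun x => by simp [Subtype.ext_iff])
  have h₂ : Module.length R (M ⧸ B) = Module.length R (LinearMap.range g) +
      Module.length R ((M ⧸ B) ⧸ LinearMap.range g) :=
    Module.length_eq_add_of_exact (LinearMap.range g).subtype (LinearMap.range g).mkQ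
      (Submodule.subtype_injective _) (Submodule.mkQ_surjective _) (fun x => by simp)
  have hr : LinearMap.range g = (LinearMap.range f).map B.mkQ := by
    rw [Submodule.range_mapQ]
  have h₃ : Module.length R ((M ⧸ B) ⧸ LinearMap.range g) =
      Module.length R (M ⧸ (LinearMap.range f ⊔ B)) :=
    LinearEquiv.length_eq (Submodule.quotEquivOfEq _ _ hr ≪≫ₗ
      Submodule.quotientQuotientEquivQuotientSup B (LinearMap.range f) ≪≫ₗ
      Submodule.quotEquivOfEq _ _ (sup_comm _ _))
  rw [h₁, h₂, h₃]
  ring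

/-- The length of `M ⧸ I ^ n • M`, as a natural number. -/
noncomputable def adicLength (I : Ideal R) (M : Type*) [AddCommGroup M] [Module R M] (n : ℕ) : ℕ :=
  (Module.length R (M ⧸ I ^ n • (⊤ : Submodule R M))).toNat

theorem adicLength_zero (I : Ideal R) : adicLength I M 0 = 0 := by
  have : Subsingleton (M ⧸ I ^ 0 • (⊤ : Submodule R M)) := by
    rw [pow_zero, Ideal.one_eq_top, Submodule.top_smul]; infer_instance
  rw [adicLength, Module.length_eq_zero, ENat.toNat_zero]

open scoped Pointwise

variable {I : Ideal R} {k : ℕ}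

theorem range_lsmul_eq_smul_top (x : R) :
    LinearMap.range (LinearMap.lsmul R M x) = x • (⊤ : Submodule R M) := by
  rw [← Submodule.map_top]; rfl

theorem pow_smul_top_le_comap_lsmul {x : R} (hx : x ∈ I) (n : ℕ) :
    I ^ n • (⊤ : Submodule R M) ≤
      (I ^ (n + 1) • (⊤ : Submodule R M)).comap (LinearMap.lsmul R M x) := by
  intro z hz
  rw [pow_succ', Submodule.mul_smul]
  exact Submodule.smul_mem_smul hx hz

theorem length_quotSMulTop_quotient (x : R) (J : Ideal R) :
    Module.length R (QuotSMulTop x M ⧸ J • (⊤ : Submodule R (QuotSMulTop x M))) =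
      Module.length R (M ⧸ (LinearMap.range (LinearMap.lsmul R M x) ⊔ J • ⊤)) :=
  LinearEquiv.length_eq (Submodule.quotEquivOfEq _ _ (by
      rw [Submodule.map_smul'', Submodule.map_top, Submodule.range_mkQ]) ≪≫ₗ
    Submodule.quotientQuotientEquivQuotientSup (x • (⊤ : Submodule R M)) (J • ⊤) ≪≫ₗ
    Submodule.quotEquivOfEq _ _ (by rw [range_lsmul_eq_smul_top]))

variable [IsNoetherianRing R] [IsLocalRing R] [Module.Finite R M]

theorem coe_adicLength (hI : IsLocalRing.maximalIdeal R ^ k ≤ I) (n : ℕ) :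
    (adicLength I M n : ℕ∞) = Module.length R (M ⧸ I ^ n • (⊤ : Submodule R M)) := by
  refine ENat.natCast_toNat (Module.length_ne_top_iff.2 ?_)
  refine isFiniteLength_quotient_smul_top (k := k * n) ?_
  rw [pow_mul]
  exact Ideal.pow_right_mono hI n

theorem length_succ_add_length_ker {x : R} (hx : x ∈ I)
    (hI : IsLocalRing.maximalIdeal R ^ k ≤ I) (n : ℕ) :
    (adicLength I M (n + 1) : ℕ∞) + Module.length R (LinearMap.ker
      (Submodule.mapQ _ _ (LinearMap.lsmul R M x) (pow_smul_top_le_comap_lsmul hx n))) =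
      adicLength I M n + adicLength I (QuotSMulTop x M) (n + 1) := by
  rw [coe_adicLength hI, coe_adicLength hI, coe_adicLength hI, length_quotSMulTop_quotient,
    length_quotient_add_length_ker_mapQ]

theorem adicLength_succ_le {x : R} (hx : x ∈ I) (hI : IsLocalRing.maximalIdeal R ^ k ≤ I) (n : ℕ) :
    adicLength I M (n + 1) ≤ adicLength I M n + adicLength I (QuotSMulTop x M) (n + 1) := by
  have := length_succ_add_length_ker (M := M) hx hI n
  exact_mod_cast le_self_add.trans this.le

theorem adicLength_succ_eq {x : R} (hx : x ∈ I) (hI : IsLocalRing.maximalIdeal R ^ k ≤ I) {n : ℕ}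
    (hn : ∀ z : M, x • z ∈ I ^ (n + 1) • (⊤ : Submodule R M) → z ∈ I ^ n • (⊤ : Submodule R M)) :
    adicLength I M (n + 1) = adicLength I M n + adicLength I (QuotSMulTop x M) (n + 1) := by
  have := length_succ_add_length_ker (M := M) hx hI n
  have hker : LinearMap.ker (Submodule.mapQ _ _ (LinearMap.lsmul R M x)
      (pow_smul_top_le_comap_lsmul hx n)) = ⊥ := by
    rw [Submodule.ker_mapQ, ← le_bot_iff, Submodule.map_le_iff_le_comap]
    intro z hz
    simpa using hn z hz
  rw [hker, Module.length_bot, add_zero] at this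
  exact_mod_cast this

theorem adicLength_quotSMulTop_one {x : R} (hx : x ∈ I) (hI : IsLocalRing.maximalIdeal R ^ k ≤ I) :
    adicLength I (QuotSMulTop x M) 1 = adicLength I M 1 := by
  have := adicLength_succ_eq (M := M) hx hI (n := 0) (fun z _ => by simp)
  rw [adicLength_zero, zero_add, zero_add] at this
  exact this.symm

theorem pow_smul_eq_bot_of_adicLength_succ_eq (hIm : I ≤ IsLocalRing.maximalIdeal R)
    (hI : IsLocalRing.maximalIdeal R ^ k ≤ I) {n : ℕ}
    (h : adicLength I M (n + 1) = adicLength I M n) : I ^ n • (⊤ : Submodule R M) = ⊥ := by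
  have hle : I ^ (n + 1) • (⊤ : Submodule R M) ≤ (I ^ n • (⊤ : Submodule R M)).comap LinearMap.id :=
    Submodule.smul_mono_left (Ideal.pow_le_pow_right (by omega))
  have key := length_quotient_add_length_ker_mapQ LinearMap.id _ _ hle
  have hsub : Subsingleton (M ⧸ (LinearMap.range (LinearMap.id : M →ₗ[R] M) ⊔
      I ^ n • (⊤ : Submodule R M))) := by
    rw [LinearMap.range_id, top_sup_eq]; infer_instance
  rw [Module.length_eq_zero (M := M ⧸ (_ ⊔ _)), ← coe_adicLength hI, ← coe_adicLength hI, h,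
    add_zero] at key
  have hker : Module.length R (LinearMap.ker (Submodule.mapQ _ _ _ hle)) = 0 :=
    WithTop.add_left_cancel (ENat.natCast_ne_top _) (key.trans (add_zero _).symm)
  rw [Module.length_eq_zero_iff, Submodule.subsingleton_iff_eq_bot, Submodule.ker_mapQ,
    ← le_bot_iff, Submodule.map_le_iff_le_comap] at hker
  refine Submodule.eq_bot_of_le_smul_of_le_jacobson_bot I _ (IsNoetherian.noetherian _) ?_ ?_
  · rw [← Submodule.mul_smul, ← pow_succ']
    intro z hz
    simpa using hker hz
  · rwa [IsLocalRing.jacobson_eq_maximalIdeal ⊥ bot_ne_top]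

/-- The length of `I ^ (n + 1) M ⧸ x I ^ n M` measures the defect of the Hilbert function. -/
theorem exists_adicLength_defect {x : R} (hx : x ∈ I) (hxM : IsSMulRegular M x)
    (hI : IsLocalRing.maximalIdeal R ^ k ≤ I)
    (hfin : IsFiniteLength R (QuotSMulTop x M)) :
    ∃ v : ℕ → ℕ, ∀ n, adicLength I M (n + 1) + v n =
      adicLength I M n + (Module.length R (QuotSMulTop x M)).toNat ∧
      (v n = 0 ↔ I ^ (n + 1) • (⊤ : Submodule R M) ≤ x • I ^ n • (⊤ : Submodule R M)) := by
  suffices ∀ n, ∃ v : ℕ, adicLength I M (n + 1) + v =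
      adicLength I M n + (Module.length R (QuotSMulTop x M)).toNat ∧
      (v = 0 ↔ I ^ (n + 1) • (⊤ : Submodule R M) ≤ x • I ^ n • (⊤ : Submodule R M)) from
    ⟨fun n => (this n).choose, fun n => (this n).choose_spec⟩
  intro n
  set A := I ^ n • (⊤ : Submodule R M)
  have h₁ : A ≤ (x • A).comap (LinearMap.lsmul R M x) :=
    fun z hz => Submodule.smul_mem_pointwise_smul _ _ _ hz
  have h₂ : x • A ≤ (I ^ (n + 1) • (⊤ : Submodule R M)).comap LinearMap.id := by
    intro z hz
    obtain ⟨w, hw, rfl⟩ := (Submodule.mem_smul_pointwise_iff_exists _ _ _).1 hz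
    exact pow_smul_top_le_comap_lsmul hx n hw
  have e₁ := length_quotient_add_length_ker_mapQ _ _ _ h₁
  have e₂ := length_quotient_add_length_ker_mapQ _ _ _ h₂
  have hker : LinearMap.ker (Submodule.mapQ _ _ (LinearMap.lsmul R M x) h₁) = ⊥ := by
    rw [Submodule.ker_mapQ, ← le_bot_iff, Submodule.map_le_iff_le_comap]
    intro z hz
    obtain ⟨w, hw, hwz⟩ := (Submodule.mem_smul_pointwise_iff_exists _ _ _).1 hz
    have : w = z := hxM hwz
    subst this
    simpa using hw
  have hsub : Subsingleton (M ⧸ (LinearMap.range (LinearMap.id : M →ₗ[R] M) ⊔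
      I ^ (n + 1) • (⊤ : Submodule R M))) := by
    rw [LinearMap.range_id, top_sup_eq]; infer_instance
  have hrange : LinearMap.range (LinearMap.lsmul R M x) ⊔ x • A = x • ⊤ := by
    rw [range_lsmul_eq_smul_top, sup_eq_left]
    intro z hz
    obtain ⟨w, -, rfl⟩ := (Submodule.mem_smul_pointwise_iff_exists _ _ _).1 hz
    exact Submodule.smul_mem_pointwise_smul _ _ _ trivial
  rw [hker, Module.length_bot, add_zero, hrange, ← coe_adicLength hI,
    ← ENat.natCast_toNat (Module.length_ne_top_iff.2 hfin)] at e₁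
  rw [Module.length_eq_zero (M := M ⧸ (_ ⊔ _)), add_zero, e₁, ← coe_adicLength hI] at e₂
  set K := LinearMap.ker (Submodule.mapQ _ _ LinearMap.id h₂) with hK
  have hKtop : Module.length R K ≠ ⊤ := fun h => by
    rw [h, add_top] at e₂
    exact absurd e₂ (by simp [← Nat.cast_add])
  refine ⟨(Module.length R K).toNat, ?_, ?_⟩
  · rw [← ENat.natCast_toNat hKtop] at e₂
    exact_mod_cast e₂
  · rw [ENat.toNat_eq_zero, or_iff_left hKtop, Module.length_eq_zero_iff,
      Submodule.subsingleton_iff_eq_bot, hK, Submodule.ker_mapQ, ← le_bot_iff,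
      Submodule.map_le_iff_le_comap]
    simp only [Submodule.comap_id, Submodule.comap_bot, Submodule.ker_mkQ]

end Length

section Bound

/-- The value at `n` of the numerical polynomial of degree `d` with normalized coefficients `e`. -/
def hilbertSum (d : ℕ) (e : ℕ → ℤ) (n : ℕ) : ℤ :=
  ∑ i ∈ Finset.range (d + 1), (-1 : ℤ) ^ i * e i * ((n + d - i).choose (d - i))

/-- The bound `a * C(n + d, d) + b * C(n + d - 1, d) + C(n - s - 1 + d, d)`, with the last term
omitted if `n ≤ s`. -/
def chooseBound (d : ℕ) (a b : ℤ) (s n : ℕ) : ℤ :=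
  a * ((n + d).choose d) + b * ((n + d - 1).choose d) +
    (if n ≤ s then 0 else ((n - (s + 1) + d).choose d : ℤ))

theorem hilbertSum_succ_succ (d : ℕ) (e : ℕ → ℤ) (n : ℕ) :
    hilbertSum (d + 1) e (n + 1) = hilbertSum (d + 1) e n + hilbertSum d e (n + 1) := by
  rw [hilbertSum, hilbertSum, hilbertSum, Finset.sum_range_succ _ (d + 1),
    Finset.sum_range_succ _ (d + 1),
    add_right_comm (Finset.sum _ _), ← Finset.sum_add_distrib]
  congr 1
  · refine Finset.sum_congr rfl fun i hi => ?_
    have hi' : i ≤ d := Nat.lt_succ_iff.1 (Finset.mem_range.1 hi)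
    rw [show n + 1 + (d + 1) - i = (n + 1 + d - i) + 1 by omega,
      show d + 1 - i = (d - i) + 1 by omega, show n + (d + 1) - i = n + 1 + d - i by omega,
      Nat.choose_succ_succ]
    push_cast
    ring
  · simp

theorem chooseBound_succ_succ (d : ℕ) (a b : ℤ) (s n : ℕ) :
    chooseBound (d + 1) a b s (n + 1) =
      chooseBound (d + 1) a b s n + chooseBound d a b s (n + 1) := by
  have h₁ : (n + 1 + (d + 1)).choose (d + 1) =
      (n + 1 + d).choose d + (n + (d + 1)).choose (d + 1) := by
    rw [← add_assoc (n + 1), Nat.choose_succ_succ, show n + 1 + d = n + (d + 1) by omega]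
  have h₂ : (n + 1 + (d + 1) - 1).choose (d + 1) =
      (n + 1 + d - 1).choose d + (n + (d + 1) - 1).choose (d + 1) := by
    rw [show n + 1 + (d + 1) - 1 = (n + d) + 1 by omega, Nat.choose_succ_succ,
      show n + 1 + d - 1 = n + d by omega, show n + (d + 1) - 1 = n + d by omega]
  simp only [chooseBound, h₁, h₂]
  rcases lt_trichotomy n s with h | rfl | h
  · rw [if_pos (by omega), if_pos (by omega), if_pos (by omega)]
    push_cast
    ring
  · rw [if_neg (by omega), if_pos le_rfl, if_neg (by omega), Nat.sub_self]
    simp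
    ring
  · have h₃ : (n + 1 - (s + 1) + (d + 1)).choose (d + 1) =
        (n + 1 - (s + 1) + d).choose d + (n - (s + 1) + (d + 1)).choose (d + 1) := by
      rw [← add_assoc, Nat.choose_succ_succ,
        show n + 1 - (s + 1) + d = n - (s + 1) + (d + 1) by omega]
    rw [if_neg (by omega), if_neg (by omega), if_neg (by omega), h₃]
    push_cast
    ring

theorem chooseBound_zero (d : ℕ) (a b : ℤ) (s : ℕ) : chooseBound (d + 1) a b s 0 = a := by
  simp [chooseBound]

theorem chooseBound_one (a b : ℤ) (s n : ℕ) :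
    chooseBound 1 a b s n = a * (n + 1) + b * n + if n ≤ s then 0 else (n - s : ℤ) := by
  rw [chooseBound]
  split_ifs with h
  · simp
  · rw [Nat.choose_one_right, Nat.choose_one_right, Nat.choose_one_right]
    push_cast [show s + 1 ≤ n by omega]
    simp
    ring

theorem exists_chooseBound_one {L v : ℕ → ℕ} {E N T : ℕ} {e₁ : ℤ} (h₀ : L 0 = 0)
    (hL : ∀ n, L (n + 1) + v n = L n + E) (hv : ∀ n, v n = 0 → v (n + 1) = 0)
    (hT : ∀ n ≥ T, v n = 0) (hN : ∀ n ≥ N, (L (n + 1) : ℤ) = E * (n + 1) - e₁) :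
    ∃ s : ℕ, (s : ℤ) = e₁ - E + L 1 ∧
      ∀ n, (L (n + 1) : ℤ) ≤ chooseBound 1 (L 1) (E - L 1 - 1) s n := by
  set W : ℕ → ℕ := fun n => ∑ i ∈ Finset.range n, v (i + 1)
  have hLW : ∀ n, (L (n + 1) : ℤ) = (n + 1) * E - v 0 - W n := by
    intro n
    induction n with
    | zero =>
      have := hL 0
      rw [h₀, zero_add, zero_add] at this
      simp [W]
      omega
    | succ n ih =>
      have := hL (n + 1)
      simp only [W, Finset.sum_range_succ] at ih ⊢
      zify at this
      push_cast at ih ⊢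
      linarith
  have hv' : ∀ n m, n ≤ m → v n = 0 → v m = 0 := by
    intro n m hnm h
    induction m, hnm using Nat.le_induction with
    | base => exact h
    | succ m _ ih => exact hv m ih
  have hWc : ∀ n m, n ≤ m → v n = 0 → W m = W n := by
    intro n m hnm h
    induction m, hnm using Nat.le_induction with
    | base => rfl
    | succ m hm ih =>
      simp only [W, Finset.sum_range_succ] at ih ⊢
      rw [ih, hv' n (m + 1) (by omega) h, add_zero]
  have hT0 := hT T le_rfl
  have hW1 := hLW 0
  have hWN := hLW (max N T)
  rw [hN _ (le_max_left _ _), hWc T _ (le_max_right _ _) hT0] at hWN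
  refine ⟨W T, ?_, fun n => ?_⟩
  · simp [W] at hW1 ⊢
    simp [W] at hWN
    linarith
  · have hmin : min n (W T) ≤ W n := by
      by_cases h : v n = 0
      · rw [← hWc n _ (le_max_left n T) h, hWc T _ (le_max_right n T) hT0]
        exact min_le_right _ _
      · refine (min_le_left _ _).trans ?_
        have : ∑ i ∈ Finset.range n, 1 ≤ W n := Finset.sum_le_sum fun i hi =>
          Nat.one_le_iff_ne_zero.2 fun h' => h (hv' _ _ (Finset.mem_range.1 hi) h')
        simpa using this
    have hW0 : W 0 = 0 := by simp [W]
    rw [chooseBound_one, hLW n]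
    rw [hW0] at hW1
    push_cast at hW1
    split_ifs with h
    · rw [min_eq_left h] at hmin
      have : (n : ℤ) ≤ W n := by exact_mod_cast hmin
      linarith
    · rw [min_eq_right (by omega)] at hmin
      have : (W T : ℤ) ≤ W n := by exact_mod_cast hmin
      linarith

end Bound

section Module

universe v

variable {R : Type*} [CommRing R] [IsNoetherianRing R] [IsLocalRing R] {I : Ideal R} {k : ℕ}

open scoped Pointwise

theorem smul_top_le_of_quotSMulTop_eq_bot {R M : Type*} [CommRing R] [AddCommGroup M] [Module R M]
    {x : R} {J : Ideal R} (h : J • (⊤ : Submodule R (QuotSMulTop x M)) = ⊥) :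
    J • (⊤ : Submodule R M) ≤ x • ⊤ := by
  rw [← Submodule.ker_mkQ (x • (⊤ : Submodule R M)), ← Submodule.comap_bot,
    ← Submodule.map_le_iff_le_comap, Submodule.map_smul'', Submodule.map_top, Submodule.range_mkQ]
  exact h.le

theorem exists_adicLength_le_one (u : ℕ → R) (hu : ∀ i j, i ≠ j → IsUnit (u i - u j))
    (hIm : I ≤ IsLocalRing.maximalIdeal R) (hI : IsLocalRing.maximalIdeal R ^ k ≤ I)
    (M : Type*) [AddCommGroup M] [Module R M] [Module.Finite R M]
    (hM : HasWeaklyRegularSeq (IsLocalRing.maximalIdeal R) 1 M) (e : ℕ → ℤ)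
    (he : ∃ N, ∀ n ≥ N, (adicLength I M (n + 1) : ℤ) = hilbertSum 1 e n) :
    ∃ s : ℕ, (s : ℤ) = e 1 - e 0 + adicLength I M 1 ∧
      ∀ n, (adicLength I M (n + 1) : ℤ) ≤
        chooseBound 1 (adicLength I M 1) (e 0 - adicLength I M 1 - 1) s n := by
  obtain ⟨N, hN⟩ := he
  obtain ⟨x, hxI, hxM, -, c, hc⟩ := exists_superficial u hu hIm hI hM
  have he : ∀ n ≥ N, (adicLength I M (n + 1) : ℤ) = e 0 * (n + 1) - e 1 := by
    intro n hn
    rw [hN n hn, hilbertSum]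
    simp [Finset.sum_range_succ]
    ring
  have hconst : ∀ n ≥ max N c, (adicLength I (QuotSMulTop x M) (n + 2) : ℤ) = e 0 := by
    intro n hn
    have h₁ := adicLength_succ_eq (M := M) hxI hI (hc (n + 1) (by omega))
    have h₂ := he n (by omega)
    have h₃ := he (n + 1) (by omega)
    rw [h₁] at h₃
    push_cast at h₃
    linarith
  have hbot : ∀ n ≥ max N c, I ^ (n + 2) • (⊤ : Submodule R (QuotSMulTop x M)) = ⊥ := by
    intro n hn
    refine pow_smul_eq_bot_of_adicLength_succ_eq hIm hI ?_
    have h₁ := hconst n hn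
    have h₂ := hconst (n + 1) (by omega)
    exact_mod_cast h₂.trans h₁.symm
  have eqv := Submodule.quotEquivOfEqBot _ (hbot _ le_rfl)
  have hlen := coe_adicLength (M := QuotSMulTop x M) hI (max N c + 2)
  rw [eqv.length_eq] at hlen
  have hfin : IsFiniteLength R (QuotSMulTop x M) :=
    Module.length_ne_top_iff.1 (hlen ▸ ENat.natCast_ne_top _)
  have hE : ((Module.length R (QuotSMulTop x M)).toNat : ℤ) = e 0 := by
    rw [← hlen, ENat.toNat_natCast, hconst _ le_rfl]
  obtain ⟨v, hv⟩ := exists_adicLength_defect hxI hxM hI hfin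
  rw [← hE]
  refine exists_chooseBound_one (v := v) (N := N) (T := max N c + 2) (adicLength_zero I)
    (fun n => (hv n).1) (fun n h => ?_) (fun n hn => ?_) fun n hn => by rw [he n hn, hE]
  · rw [(hv _).2] at h ⊢
    have hcomm : x • I • I ^ n • (⊤ : Submodule R M) = I • x • I ^ n • ⊤ :=
      Submodule.map_smul'' _ _ _
    rw [pow_succ', Submodule.mul_smul, pow_succ' I n, Submodule.mul_smul, hcomm]
    rw [pow_succ', Submodule.mul_smul] at h
    exact Submodule.smul_mono le_rfl h
  · rw [(hv _).2]
    intro z hz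
    obtain ⟨m, rfl⟩ := Nat.exists_eq_add_of_le' (show 2 ≤ n by omega)
    obtain ⟨w, -, rfl⟩ := (Submodule.mem_smul_pointwise_iff_exists _ _ _).1
      (smul_top_le_of_quotSMulTop_eq_bot (hbot (m + 1) (by omega)) hz)
    exact Submodule.smul_mem_pointwise_smul _ _ _ (hc _ (by omega) w hz)

/-- The bound for the Hilbert function of a module of depth at least `d + 1` whose Hilbert polynomial
has degree at most `d + 1`. -/
theorem exists_adicLength_le (u : ℕ → R) (hu : ∀ i j, i ≠ j → IsUnit (u i - u j))
    (hIm : I ≤ IsLocalRing.maximalIdeal R) (hI : IsLocalRing.maximalIdeal R ^ k ≤ I) (d : ℕ)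
    (M : Type v) [AddCommGroup M] [Module R M] [Module.Finite R M]
    (hM : HasWeaklyRegularSeq (IsLocalRing.maximalIdeal R) (d + 1) M) (e : ℕ → ℤ)
    (he : ∃ N, ∀ n ≥ N, (adicLength I M (n + 1) : ℤ) = hilbertSum (d + 1) e n) :
    ∃ s : ℕ, (s : ℤ) = e 1 - e 0 + adicLength I M 1 ∧
      ∀ n, (adicLength I M (n + 1) : ℤ) ≤
        chooseBound (d + 1) (adicLength I M 1) (e 0 - adicLength I M 1 - 1) s n := by
  induction d generalizing M with
  | zero => exact exists_adicLength_le_one u hu hIm hI M hM e he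
  | succ d ih =>
    obtain ⟨N, hN⟩ := he
    obtain ⟨x, hxI, -, hM', c, hc⟩ := exists_superficial u hu hIm hI hM
    obtain ⟨s, hs, hle⟩ := ih (QuotSMulTop x M) hM' ⟨max N c + 1, fun n hn => by
      obtain ⟨m, rfl⟩ := Nat.exists_eq_add_of_le' (show 1 ≤ n by omega)
      have h₁ := adicLength_succ_eq (M := M) hxI hI (hc (m + 1) (by omega))
      have h₂ := hN m (by omega)
      have h₃ := hN (m + 1) (by omega)
      rw [h₁, hilbertSum_succ_succ] at h₃
      push_cast at h₃
      linarith⟩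
    rw [adicLength_quotSMulTop_one hxI hI] at hs hle
    refine ⟨s, hs, fun n => ?_⟩
    induction n with
    | zero => rw [chooseBound_zero]
    | succ n ihn =>
      rw [chooseBound_succ_succ]
      have := adicLength_succ_le (M := M) hxI hI (n + 1)
      have h₁ := hle (n + 1)
      zify at this
      linarith

end Module

section BaseChange

open Polynomial

variable {R : Type*} [CommRing R] [IsLocalRing R]

theorem length_quotient_map_pow_smul_top {S : Type*} [CommRing S] [IsLocalRing S] [Algebra R S]
    [IsLocalHom (algebraMap R S)] [Module.Flat R S]
    (hS : (IsLocalRing.maximalIdeal R).map (algebraMap R S) = IsLocalRing.maximalIdeal S)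
    (I : Ideal R) (n : ℕ) :
    Module.length S (S ⧸ (I.map (algebraMap R S)) ^ n • (⊤ : Submodule S S)) =
      Module.length R (R ⧸ I ^ n) := by
  have : IsSimpleModule S (S ⧸ IsLocalRing.maximalIdeal S) :=
    isSimpleModule_iff_isCoatom.2 (IsLocalRing.maximalIdeal.isMaximal S).out
  have h := IsLocalRing.length_baseChange R S (R ⧸ I ^ n)
  rw [hS, Module.length_eq_one S (S ⧸ IsLocalRing.maximalIdeal S), mul_one] at h
  rw [← h]
  refine LinearEquiv.length_eq (Submodule.quotEquivOfEq _ _ ?_ ≪≫ₗ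
    (Algebra.TensorProduct.quotIdealMapEquivTensorQuot S (I ^ n)).toLinearEquiv)
  rw [Ideal.map_pow, smul_eq_mul, Ideal.mul_top]

universe w

/-- A Noetherian local ring has a flat local Noetherian extension with the same maximal ideal
and infinite residue field, namely `R[X]` localized at `𝔪[X]`. -/
theorem exists_flat_extension (R : Type w) [CommRing R] [IsLocalRing R] [IsNoetherianRing R] :
    ∃ (S : Type w) (_ : CommRing S) (_ : IsLocalRing S) (_ : IsNoetherianRing S) (_ : Algebra R S),
      IsLocalHom (algebraMap R S) ∧ Module.Flat R S ∧
      (IsLocalRing.maximalIdeal R).map (algebraMap R S) = IsLocalRing.maximalIdeal S ∧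
      ∃ u : ℕ → S, ∀ i j, i ≠ j → IsUnit (u i - u j) := by
  have hP : ((IsLocalRing.maximalIdeal R).map (C : R →+* R[X])).IsPrime :=
    Ideal.isPrime_map_C_of_isPrime
  set P := (IsLocalRing.maximalIdeal R).map (C : R →+* R[X])
  have hflat : Module.Flat R[X] (Localization.AtPrime P) := IsLocalization.flat _ P.primeCompl
  have hmap : (IsLocalRing.maximalIdeal R).map (algebraMap R (Localization.AtPrime P)) =
      IsLocalRing.maximalIdeal (Localization.AtPrime P) := by
    rw [IsScalarTower.algebraMap_eq R R[X], ← Ideal.map_map, Polynomial.algebraMap_eq]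
    exact Localization.AtPrime.map_eq_maximalIdeal
  refine ⟨Localization.AtPrime P, inferInstance, inferInstance,
    IsLocalization.isNoetherianRing P.primeCompl _ inferInstance, inferInstance, ?_,
    Module.Flat.trans R R[X] _, hmap,
    fun i => algebraMap R[X] _ (X ^ i), fun i j hij => ?_⟩
  · refine ((IsLocalRing.local_hom_TFAE _).out 2 0).1 hmap.le
  · rw [← map_sub, IsLocalization.AtPrime.isUnit_to_map_iff _ P]
    intro h
    have := Ideal.mem_map_C_iff.1 h i
    rw [coeff_sub, coeff_X_pow_self, coeff_X_pow, if_neg hij, sub_zero] at this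
    exact (Ideal.ne_top_iff_one _).1 (IsLocalRing.maximalIdeal.isMaximal R).ne_top this

end BaseChange

/-- **Rossi–Valla–Vasconcelos (2001), Theorem 3.3**.  Let `(R,m)` be a Cohen-Macaulay
Noetherian local ring of dimension `d ≥ 1` and `I` an `m`-primary ideal.  With
`s = e₁(I) - e₀(I) + λ(R/I)`, for every `n ≥ 0` one has
`λ(R/I^(n+1)) ≤ λ(R/I)·C(n+d,d) + (e₀(I) - λ(R/I) - 1)·C(n+d-1,d) + C(n-s-1+d,d)`,
where the last term is interpreted as `0` when `n ≤ s`. -/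
theorem hilbert_series_bound_via_sally_multiplicity
    {R : Type*} [CommRing R] [IsNoetherianRing R] [IsLocalRing R]
    (d : ℕ) (hd : 1 ≤ d) (hdim : ringKrullDim R = d)
    (hCM : IsCohenMacaulayLocalRing R)
    (I : Ideal R) (hI : I.radical = maximalIdeal R)
    (e : ℕ → ℤ) (he : HasHilbertCoeffs I d e)
    (lI : ℕ) (hlI : moduleLength R (R ⧸ I) = (lI : WithBot ℕ∞))
    (s : ℤ) (hs : s = e 1 - e 0 + lI) :
    ∀ n : ℕ, ∃ l : ℕ,
      moduleLength R (R ⧸ I ^ (n + 1)) = (l : WithBot ℕ∞) ∧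
      (l : ℤ) ≤ (lI : ℤ) * ((n + d).choose d) + (e 0 - lI - 1) * ((n + d - 1).choose d) +
        (if (n : ℤ) ≤ s then 0 else (((n : ℤ) - s - 1 + d).toNat.choose d : ℤ)) := by
  obtain ⟨S, _, _, _, _, _, _, hS, u, hu⟩ := exists_flat_extension R
  obtain ⟨k, hk⟩ := Ideal.exists_radical_pow_le_of_fg I (IsNoetherian.noetherian _)
  rw [hI] at hk
  set J := I.map (algebraMap R S)
  have hJm : J ≤ maximalIdeal S := hS ▸ Ideal.map_mono (hI ▸ Ideal.le_radical)
  have hmJ : maximalIdeal S ^ k ≤ J := by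
    rw [← hS, ← Ideal.map_pow]
    exact Ideal.map_mono hk
  have hlen : ∀ n, Module.length R (R ⧸ I ^ n) = adicLength J S n := fun n => by
    rw [coe_adicLength hmJ, length_quotient_map_pow_smul_top hS]
  have hlen' : ∀ n, moduleLength R (R ⧸ I ^ n) = (adicLength J S n : WithBot ℕ∞) := fun n => by
    rw [moduleLength, ← Module.coe_length, hlen]
    rfl
  obtain ⟨d, rfl⟩ := Nat.exists_eq_add_of_le' hd
  obtain ⟨rs, hrs, hreg, hrsl⟩ := hCM
  have hseq : HasWeaklyRegularSeq (maximalIdeal S) (d + 1) S := by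
    refine ⟨rs.map (algebraMap R S), ?_, ?_, hreg.toIsWeaklyRegular.of_flat⟩
    · rw [hdim] at hrsl
      rw [List.length_map]
      exact_mod_cast hrsl
    · intro y hy
      obtain ⟨x, hx, rfl⟩ := List.mem_map.1 hy
      exact hS ▸ Ideal.mem_map_of_mem _ (hrs x hx)
  have hl1 : adicLength J S 1 = lI := by
    rw [← pow_one I, hlen'] at hlI
    exact_mod_cast hlI
  obtain ⟨N, hN⟩ := he
  obtain ⟨t, ht, hle⟩ := exists_adicLength_le u hu hJm hmJ d S hseq e ⟨N, fun n hn => by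
    obtain ⟨l, hl, hle⟩ := hN n hn
    rw [hlen'] at hl
    have : adicLength J S (n + 1) = l := by exact_mod_cast hl
    rw [this, hle, hilbertSum]⟩
  rw [hl1] at ht hle
  intro n
  refine ⟨_, hlen' (n + 1), (hle n).trans_eq ?_⟩
  rw [hs, ← ht, chooseBound]
  simp only [Nat.cast_le]
  split_ifs with h
  · rfl
  · rw [show ((n : ℤ) - t - 1 + (d + 1 : ℕ)).toNat = n - (t + 1) + (d + 1) by omega]
end

section
/- Let (R,m) be a Cohen-Macaulay Noetherian local ring and let I be an ideal of height g > 0 such that R/I is Cohen-Macaulay. Then ν(I) ≤ e_0(R) + (g−1)·e_0(R/I), where ν(I) is the minimal number of generators of I, e_0(R) is the multiplicity of R with respect to m, and e_0(R/I) is the multiplicity of the local ring R/I with respect to its maximal ideal. -/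
open Finset IsLocalRing

/-- The height of an ideal: the infimum of the heights of the primes containing it. -/
noncomputable def idealHeight {R : Type*} [CommRing R] (I : Ideal R) : ℕ∞ :=
  ⨅ (p : PrimeSpectrum R) (_ : I ≤ p.asIdeal), Order.height p

section Depth

open RingTheory.Sequence Pointwise

universe u

/-- There is an `M`-regular sequence of length `n` in the maximal ideal. -/
def HasRegularSeqOfLength (R : Type*) [CommRing R] [IsLocalRing R] (M : Type*) [AddCommGroup M]
    [Module R M] (n : ℕ) : Prop :=
  ∃ rs : List R, rs.length = n ∧ (∀ r ∈ rs, r ∈ maximalIdeal R) ∧ IsRegular M rs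

lemma length_le_height_of_isRegular {R : Type*} [CommRing R] [IsNoetherianRing R] {p : Ideal R}
    [p.IsPrime] {rs : List R}
    (hrs : ∀ r ∈ rs, r ∈ p) (h : IsRegular R rs) : (rs.length : ℕ∞) ≤ p.height := by
  have h1 := h.toIsWeaklyRegular.isRegular_of_isLocalization_of_mem (Localization.AtPrime p) p hrs
  have h2 := ringKrullDim_add_length_eq_ringKrullDim_of_isRegular _ h1
  rw [IsLocalization.AtPrime.ringKrullDim_eq_height p (Localization.AtPrime p)] at h2
  have h3 := h1.quot_ofList_smul_nontrivial ⊤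
  rw [smul_eq_mul, Ideal.mul_top] at h3
  rw [← WithBot.coe_le_coe, ← h2, List.length_map]
  have h4 := ringKrullDim_nonneg_of_nontrivial (R := Localization.AtPrime p ⧸
    Ideal.ofList (rs.map (algebraMap R (Localization.AtPrime p))))
  calc ((rs.length : ℕ∞) : WithBot ℕ∞) = 0 + rs.length := by simp
    _ ≤ _ := by gcongr

variable {R : Type u} [CommRing R] [IsLocalRing R]

lemma HasRegularSeqOfLength.nontrivial {M : Type*} [AddCommGroup M] [Module R M] {n : ℕ}
    (h : HasRegularSeqOfLength R M n) : Nontrivial M := by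
  obtain ⟨rs, -, -, h⟩ := h
  exact h.nontrivial

lemma HasRegularSeqOfLength.exists_cons {M : Type*} [AddCommGroup M] [Module R M] {n : ℕ}
    (h : HasRegularSeqOfLength R M (n + 1)) :
    ∃ x ∈ maximalIdeal R, IsSMulRegular M x ∧ HasRegularSeqOfLength R (QuotSMulTop x M) n := by
  obtain ⟨rs, hl, hm, h⟩ := h
  match rs with
  | [] => simp at hl
  | a :: rs =>
    simp only [isRegular_cons_iff] at h
    simp only [List.length_cons, Nat.add_left_inj] at hl
    exact ⟨a, hm a (by simp), h.1, rs, hl, fun r hr => hm r (by simp [hr]), h.2⟩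

lemma smul_top_lt_top_of_finite {M : Type*} [AddCommGroup M] [Module R M] [Module.Finite R M]
    [Nontrivial M] : maximalIdeal R • (⊤ : Submodule R M) < ⊤ :=
  lt_top_iff_ne_top.mpr
    (Submodule.top_ne_ideal_smul_of_le_jacobson_annihilator (maximalIdeal_le_jacobson _)).symm

variable [IsNoetherianRing R]

open CategoryTheory Abelian in
/-- Dividing by any regular element lowers the depth by at most one. -/
lemma HasRegularSeqOfLength.quotSMulTop {M : Type u} [AddCommGroup M] [Module R M]
    [Module.Finite R M] {n : ℕ} (h : HasRegularSeqOfLength R M (n + 1)) {x : R}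
    (hxm : x ∈ maximalIdeal R) (hx : IsSMulRegular M x) :
    HasRegularSeqOfLength R (QuotSMulTop x M) n := by
  have := h.nontrivial
  have : Nontrivial (QuotSMulTop x M) := nontrivial_quotSMulTop_of_mem_maximalIdeal M hxm
  have h1 := ((ModuleCat.exists_isRegular_tfae (maximalIdeal R) (n + 1) (ModuleCat.of R M)
    smul_top_lt_top_of_finite).out 3 1).mp h
  refine ((ModuleCat.exists_isRegular_tfae (maximalIdeal R) n (ModuleCat.of R (QuotSMulTop x M))
    smul_top_lt_top_of_finite).out 1 3).mp fun i hi => ?_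
  have zero1 := AddCommGrpCat.isZero_of_iff_subsingleton.mpr (h1 i (by omega))
  have zero2 := AddCommGrpCat.isZero_of_iff_subsingleton.mpr (h1 (i + 1) (by omega))
  exact AddCommGrpCat.subsingleton_of_isZero <| ShortComplex.Exact.isZero_of_both_zeros
    (Ext.covariant_sequence_exact₃' _
      (IsSMulRegular.smulShortComplex_shortExact (M := ModuleCat.of R M) hx) i (i + 1) rfl)
    (zero1.eq_zero_of_src _) (zero2.eq_zero_of_tgt _)

/-- If `x` is `M`-regular, an associated prime of `M` is contained in an associated prime of
`M ⧸ xM` that contains `x`. -/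
lemma exists_isAssociatedPrime_quotSMulTop {M : Type*} [AddCommGroup M] [Module R M]
    [Module.Finite R M] {x : R} (hxm : x ∈ maximalIdeal R) (hx : IsSMulRegular M x) {p : Ideal R}
    (hp : IsAssociatedPrime p M) :
    ∃ q : Ideal R, IsAssociatedPrime q (QuotSMulTop x M) ∧ p ≤ q ∧ x ∈ q := by
  obtain ⟨hprime, y, hy⟩ := isAssociatedPrime_iff.mp hp
  set N : Submodule R M := Submodule.torsionBySet R M p
  have hyN : y ∈ N := by
    rw [Submodule.mem_torsionBySet_iff]
    rintro ⟨a, ha⟩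
    have : a ∈ (⊥ : Submodule R M).colon {y} := hy ▸ ha
    simpa [Submodule.mem_colon_singleton] using this
  have hy0 : y ≠ 0 := by
    rintro rfl
    exact hprime.ne_top (by simp [hy])
  have hN : ¬ N ≤ x • (⊤ : Submodule R M) := by
    intro hle
    have h2 : N ≤ Ideal.span {x} • N := by
      intro u hu
      obtain ⟨v, -, rfl⟩ := (Submodule.mem_smul_pointwise_iff_exists _ _ _).mp (hle hu)
      rw [Submodule.ideal_span_singleton_smul]
      refine Submodule.smul_mem_pointwise_smul v x N ?_
      rw [Submodule.mem_torsionBySet_iff] at hu ⊢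
      intro a
      apply hx
      have := hu a
      simp only [smul_zero]
      rw [smul_comm]
      exact this
    have h3 : N = ⊥ := Submodule.eq_bot_of_le_smul_of_le_jacobson_bot _ _
      (IsNoetherian.noetherian N) h2
      ((Ideal.span_singleton_le_iff_mem _).mpr (IsLocalRing.maximalIdeal_le_jacobson ⊥ hxm))
    rw [h3] at hyN
    exact hy0 (by simpa using hyN)
  obtain ⟨u, hu, hux⟩ := SetLike.not_le_iff_exists.mp hN
  obtain ⟨q, hq, hle⟩ := exists_le_isAssociatedPrime_of_isNoetherianRing R
    (M := QuotSMulTop x M) (Submodule.Quotient.mk u)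
    (fun h => hux ((Submodule.Quotient.mk_eq_zero _).mp h))
  refine ⟨q, hq, fun a ha => hle ?_, hle ?_⟩
  · rw [Submodule.mem_colon_singleton, ← Submodule.Quotient.mk_smul,
      (Submodule.mem_torsionBySet_iff _ _).mp hu ⟨a, ha⟩]
    simp
  · rw [Submodule.mem_colon_singleton, ← Submodule.Quotient.mk_smul, Submodule.mem_bot,
      Submodule.Quotient.mk_eq_zero]
    exact Submodule.smul_mem_pointwise_smul u x _ trivial

/-- The depth of a module is at most the dimension of any of its associated primes. -/
lemma HasRegularSeqOfLength.le_ringKrullDim_quotient_of_isAssociatedPrime {n : ℕ} :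
    ∀ {M : Type u} [AddCommGroup M] [Module R M] [Module.Finite R M],
      HasRegularSeqOfLength R M n → ∀ {p : Ideal R}, IsAssociatedPrime p M →
      (n : WithBot ℕ∞) ≤ ringKrullDim (R ⧸ p) := by
  induction n with
  | zero =>
    intro M _ _ _ _ p hp
    have := hp.isPrime
    simpa using ringKrullDim_nonneg_of_nontrivial
  | succ n ih =>
    intro M _ _ _ h p hp
    obtain ⟨x, hxm, hx, h'⟩ := h.exists_cons
    obtain ⟨q, hq, hpq, hxq⟩ := exists_isAssociatedPrime_quotSMulTop hxm hx hp
    have hxp : x ∉ p := by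
      have : x ∉ ⋃ p ∈ associatedPrimes R M, (p : Set R) := by
        rw [biUnion_associatedPrimes_eq_compl_regular]
        simpa using hx
      simp only [Set.mem_iUnion, not_exists] at this
      exact this p hp
    have := hp.isPrime
    have := hq.isPrime
    have h1 : ringKrullDim ((R ⧸ p) ⧸ Ideal.span {Ideal.Quotient.mk p x}) + 1 ≤
        ringKrullDim (R ⧸ p) := by
      apply ringKrullDim_quotient_succ_le_of_nonZeroDivisor
      rw [mem_nonZeroDivisors_iff_ne_zero, Ne, Ideal.Quotient.eq_zero_iff_mem]
      exact hxp
    have h2 : ringKrullDim (R ⧸ q) ≤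
        ringKrullDim ((R ⧸ p) ⧸ Ideal.span {Ideal.Quotient.mk p x}) := by
      let f : (R ⧸ p) ⧸ Ideal.span {Ideal.Quotient.mk p x} →+* R ⧸ q :=
        Ideal.Quotient.lift _ (Ideal.Quotient.factor hpq) (by
          intro a ha
          have : Ideal.span {Ideal.Quotient.mk p x} ≤ RingHom.ker (Ideal.Quotient.factor hpq) := by
            rw [Ideal.span_singleton_le_iff_mem, RingHom.mem_ker, Ideal.Quotient.factor_mk,
              Ideal.Quotient.eq_zero_iff_mem]
            exact hxq
          exact this ha)
      refine ringKrullDim_le_of_surjective f ?_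
      exact Ideal.Quotient.lift_surjective_of_surjective _ _
        (Ideal.Quotient.factor_surjective hpq)
    calc ((n + 1 : ℕ) : WithBot ℕ∞) = n + 1 := by push_cast; rfl
      _ ≤ ringKrullDim (R ⧸ q) + 1 := by gcongr; exact ih h' hq
      _ ≤ _ := by gcongr
      _ ≤ _ := h1

/-- Every proper ideal `I` contains an `M`-regular sequence of length at least
`depth M - dim R ⧸ I`. -/
lemma HasRegularSeqOfLength.exists_isRegular_le_ringKrullDim_quotient {n : ℕ} :
    ∀ {M : Type u} [AddCommGroup M] [Module R M] [Module.Finite R M],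
      HasRegularSeqOfLength R M n → ∀ {I : Ideal R}, I ≠ ⊤ →
      ∃ rs : List R, (∀ r ∈ rs, r ∈ I) ∧ IsRegular M rs ∧
        (n : WithBot ℕ∞) ≤ ringKrullDim (R ⧸ I) + rs.length := by
  induction n with
  | zero =>
    intro M _ _ _ h I hI
    have := h.nontrivial
    have : Nontrivial (R ⧸ I) := Ideal.Quotient.nontrivial_iff.mpr hI
    exact ⟨[], by simp, IsRegular.nil R M, by simpa using ringKrullDim_nonneg_of_nontrivial⟩
  | succ n ih =>
    intro M _ _ _ h I hI
    have := h.nontrivial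
    by_cases hreg : ∃ x ∈ I, IsSMulRegular M x
    · obtain ⟨x, hxI, hx⟩ := hreg
      obtain ⟨rs, hrs, hreg, hle⟩ := ih (h.quotSMulTop (le_maximalIdeal hI hxI) hx) hI
      refine ⟨x :: rs, by simpa [hxI] using hrs, (isRegular_cons_iff _ _ _).mpr ⟨hx, hreg⟩, ?_⟩
      push_cast [List.length_cons]
      rw [← add_assoc]
      gcongr
    · have hsub : (I : Set R) ⊆ ⋃ p ∈ associatedPrimes R M, (p : Set R) := by
        rw [biUnion_associatedPrimes_eq_compl_regular]
        intro x hx hx'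
        exact hreg ⟨x, hx, hx'⟩
      obtain ⟨p, hp, hIp⟩ := (Ideal.subset_union_prime_finite (associatedPrimes.finite R M)
        ⊥ ⊥ fun p hp _ _ => hp.isPrime).mp hsub
      refine ⟨[], by simp, IsRegular.nil R M, ?_⟩
      simp only [List.length_nil, CharP.cast_eq_zero, add_zero]
      exact (h.le_ringKrullDim_quotient_of_isAssociatedPrime hp).trans
        (ringKrullDim_le_of_surjective (Ideal.Quotient.factor hIp)
          (Ideal.Quotient.factor_surjective hIp))

end Depth

section HeightFormula

lemma idealHeight_add_ringKrullDim_quotient_le {R : Type*} [CommRing R] {I : Ideal R}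
    {q : ℕ} (hq : ringKrullDim (R ⧸ I) = q) :
    (idealHeight I : WithBot ℕ∞) + q ≤ ringKrullDim R := by
  rw [ringKrullDim_quotient] at hq
  obtain ⟨l, hl⟩ := (Order.le_krullDim_iff (n := q)).mp hq.ge
  let l' : LTSeries (PrimeSpectrum R) := l.map Subtype.val (Subtype.strictMono_coe _)
  have h1 : (q : ℕ∞) ≤ Order.coheight l.head.1 := by
    rw [← hl]
    exact Order.length_le_coheight (p := l') (by simp [l', LTSeries.head_map])
  have h2 : idealHeight I ≤ Order.height l.head.1 := iInf₂_le l.head.1 l.head.2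
  have : Nonempty (PrimeSpectrum R) := ⟨l.head.1⟩
  rw [ringKrullDim, Order.krullDim_eq_iSup_height_add_coheight_of_nonempty]
  have h3 : idealHeight I + q ≤ ⨆ a : PrimeSpectrum R, Order.height a + Order.coheight a :=
    le_iSup_of_le l.head.1 (by gcongr)
  exact_mod_cast h3

universe u

/-- In a Cohen–Macaulay local ring, `ht I + dim R ⧸ I = dim R`. -/
lemma HasRegularSeqOfLength.idealHeight_add_ringKrullDim_quotient {R : Type u} [CommRing R]
    [IsNoetherianRing R] [IsLocalRing R] {d : ℕ} (h : HasRegularSeqOfLength R R d)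
    (hd : ringKrullDim R = d) {I : Ideal R} {q g : ℕ} (hq : ringKrullDim (R ⧸ I) = q)
    (hg : idealHeight I = g) : g + q = d := by
  apply le_antisymm
  · have := idealHeight_add_ringKrullDim_quotient_le hq
    rw [hd, hg] at this
    exact_mod_cast this
  · have hI : ∃ p : PrimeSpectrum R, I ≤ p.asIdeal ∧ Order.height p = g := by
      obtain ⟨⟨p, hp⟩, hpg⟩ : ∃ p : {p : PrimeSpectrum R // I ≤ p.asIdeal},
          Order.height p.1 = ⨅ p : {p : PrimeSpectrum R // I ≤ p.asIdeal}, Order.height p.1 := by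
        have : Nonempty {p : PrimeSpectrum R // I ≤ p.asIdeal} := by
          by_contra hne
          rw [not_nonempty_iff] at hne
          rw [idealHeight, iInf_subtype', iInf_of_isEmpty] at hg
          simp at hg
        exact ENat.exists_eq_iInf _
      refine ⟨p, hp, hpg.trans ?_⟩
      rw [← hg, idealHeight, iInf_subtype']
    obtain ⟨p, hIp, hp⟩ := hI
    obtain ⟨rs, hrs, hreg, hle⟩ := h.exists_isRegular_le_ringKrullDim_quotient p.2.ne_top
    have h1 := length_le_height_of_isRegular hrs hreg
    rw [PrimeSpectrum.height_eq_orderHeight, hp] at h1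
    have h2 : ringKrullDim (R ⧸ p.asIdeal) ≤ q := hq ▸ ringKrullDim_le_of_surjective
      (Ideal.Quotient.factor hIp) (Ideal.Quotient.factor_surjective hIp)
    have h3 : (d : WithBot ℕ∞) ≤ q + g :=
      hle.trans (add_le_add h2 (by exact_mod_cast h1))
    have : d ≤ q + g := by exact_mod_cast h3
    omega

end HeightFormula

section HilbertCoeffs

open Pointwise

/-- `e 0, …, e d` are the Hilbert coefficients of `M` with respect to the maximal ideal,
where `d` is the degree of the Hilbert–Samuel polynomial. -/
def HasModuleHilbertCoeffs (R : Type*) [CommRing R] [IsLocalRing R] (M : Type*) [AddCommGroup M]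
    [Module R M] (d : ℕ) (e : ℕ → ℤ) : Prop :=
  ∃ N : ℕ, ∀ n ≥ N, ∃ l : ℕ,
    Module.length R (M ⧸ (maximalIdeal R ^ (n + 1) • ⊤ : Submodule R M)) = l ∧
    (l : ℤ) = ∑ i ∈ Finset.range (d + 1), (-1 : ℤ) ^ i * e i * ((n + d - i).choose (d - i))

variable {R : Type*} [CommRing R] [IsLocalRing R]

/-- Multiplication by `x` is injective on the associated graded module in large degrees, and
`x` is a nonzerodivisor. -/
def IsSuperficialOn (M : Type*) [AddCommGroup M] [Module R M] (x : R) : Prop :=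
  IsSMulRegular M x ∧ ∃ n₀, ∀ n ≥ n₀, ∀ u : M,
    x • u ∈ (maximalIdeal R ^ (n + 1) • ⊤ : Submodule R M) →
    u ∈ (maximalIdeal R ^ n • ⊤ : Submodule R M)

variable {M : Type*} [AddCommGroup M] [Module R M]

lemma length_quotient_eq_add_of_colon {R M : Type*} [CommRing R] [AddCommGroup M] [Module R M]
    {J J' : Ideal R} {x : R}
    (hJ : ∀ u ∈ (J • ⊤ : Submodule R M), x • u ∈ (J' • ⊤ : Submodule R M))
    (hx : ∀ u : M, x • u ∈ (J' • ⊤ : Submodule R M) → u ∈ (J • ⊤ : Submodule R M)) :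
    Module.length R (M ⧸ (J' • ⊤ : Submodule R M)) =
      Module.length R (M ⧸ (J • ⊤ : Submodule R M)) +
      Module.length R (QuotSMulTop x M ⧸ (J' • ⊤ : Submodule R (QuotSMulTop x M))) := by
  set π : M →ₗ[R] QuotSMulTop x M := (x • (⊤ : Submodule R M)).mkQ
  have hπ : Function.Surjective π := Submodule.mkQ_surjective _
  have hmap : (J' • ⊤ : Submodule R M).map π = J' • ⊤ := by
    rw [Submodule.map_smul'', Submodule.map_top, LinearMap.range_eq_top.mpr hπ]
  have hJ' : (J • ⊤ : Submodule R M) ≤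
      Submodule.comap (LinearMap.lsmul R M x) (J' • ⊤) := hJ
  let f : (M ⧸ (J • ⊤ : Submodule R M)) →ₗ[R] M ⧸ (J' • ⊤ : Submodule R M) :=
    Submodule.mapQ _ _ (LinearMap.lsmul R M x) hJ'
  let g : (M ⧸ (J' • ⊤ : Submodule R M)) →ₗ[R]
      QuotSMulTop x M ⧸ (J' • ⊤ : Submodule R (QuotSMulTop x M)) :=
    Submodule.mapQ _ _ π (Submodule.map_le_iff_le_comap.mp hmap.le)
  refine Module.length_eq_add_of_exact f g ?_ ?_ ?_
  · rw [← LinearMap.ker_eq_bot, LinearMap.ker_eq_bot']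
    intro u hu
    induction u using Submodule.Quotient.induction_on with | _ u =>
    simp only [f, Submodule.mapQ_apply, Submodule.Quotient.mk_eq_zero] at hu ⊢
    exact hx u hu
  · intro u
    induction u using Submodule.Quotient.induction_on with | _ u =>
    obtain ⟨v, rfl⟩ := hπ u
    exact ⟨Submodule.Quotient.mk v, rfl⟩
  · intro u
    induction u using Submodule.Quotient.induction_on with | _ u =>
    simp only [g, Submodule.mapQ_apply, Submodule.Quotient.mk_eq_zero]
    rw [← hmap]
    constructor
    · rintro ⟨p, hp, hpu⟩
      obtain ⟨v, -, hv⟩ := (Submodule.mem_smul_pointwise_iff_exists _ _ _).mp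
        ((Submodule.Quotient.eq _).mp hpu)
      refine ⟨Submodule.Quotient.mk (-v), ?_⟩
      simp only [f, Submodule.mapQ_apply]
      rw [Submodule.Quotient.eq, LinearMap.lsmul_apply, smul_neg, hv]
      convert Submodule.neg_mem _ hp using 1
      abel
    · rintro ⟨v, hv⟩
      induction v using Submodule.Quotient.induction_on with | _ v =>
      simp only [f, Submodule.mapQ_apply, Submodule.Quotient.eq] at hv
      refine ⟨u - x • v, ?_, ?_⟩
      · convert Submodule.neg_mem _ hv using 1
        simp
      · rw [map_sub, sub_eq_self]
        exact (Submodule.Quotient.mk_eq_zero _).mpr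
          (Submodule.smul_mem_pointwise_smul v x _ trivial)

lemma sum_hilbert_pascal (e : ℕ → ℤ) (n d : ℕ) (hn : 0 < n) :
    ∑ i ∈ Finset.range (d + 1 + 1), (-1 : ℤ) ^ i * e i *
        ((n + (d + 1) - i).choose (d + 1 - i)) =
      ∑ i ∈ Finset.range (d + 1 + 1), (-1 : ℤ) ^ i * e i *
        ((n - 1 + (d + 1) - i).choose (d + 1 - i)) +
      ∑ i ∈ Finset.range (d + 1), (-1 : ℤ) ^ i * e i * ((n + d - i).choose (d - i)) := by
  rw [Finset.sum_range_succ _ (d + 1), Finset.sum_range_succ _ (d + 1), add_right_comm,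
    ← Finset.sum_add_distrib]
  congr 1
  · refine Finset.sum_congr rfl fun i hi => ?_
    have hi : i ≤ d := by simpa [Nat.lt_succ_iff] using hi
    rw [show n + (d + 1) - i = (n + d - i) + 1 by omega, show d + 1 - i = (d - i) + 1 by omega,
      show n - 1 + (d + 1) - i = n + d - i by omega, Nat.choose_succ_succ]
    push_cast
    ring
  · simp

lemma HasModuleHilbertCoeffs.quotSMulTop {d : ℕ} {e : ℕ → ℤ}
    (h : HasModuleHilbertCoeffs R M (d + 1) e) {x : R} (hxm : x ∈ maximalIdeal R)
    (hx : IsSuperficialOn M x) : HasModuleHilbertCoeffs R (QuotSMulTop x M) d e := by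
  obtain ⟨N, hN⟩ := h
  obtain ⟨-, n₀, hn₀⟩ := hx
  refine ⟨N + n₀ + 1, fun n hn => ?_⟩
  obtain ⟨l₁, h₁, e₁⟩ := hN n (by omega)
  obtain ⟨l₀, h₀, e₀⟩ := hN (n - 1) (by omega)
  rw [Nat.sub_add_cancel (by omega)] at h₀
  have hlen := length_quotient_eq_add_of_colon (M := M) (J := maximalIdeal R ^ n)
    (J' := maximalIdeal R ^ (n + 1)) (x := x) (fun u hu => by
      rw [pow_succ', Submodule.mul_smul]
      exact Submodule.smul_mem_smul hxm hu) (fun u hu => hn₀ n (by omega) u hu)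
  rw [h₁, h₀] at hlen
  obtain ⟨l', hl'⟩ : ∃ l' : ℕ, Module.length R (QuotSMulTop x M ⧸
      (maximalIdeal R ^ (n + 1) • ⊤ : Submodule R (QuotSMulTop x M))) = l' := by
    refine ⟨_, (ENat.natCast_toNat fun htop => ?_).symm⟩
    rw [htop] at hlen
    simp at hlen
  rw [hl'] at hlen
  have hlen : l₁ = l₀ + l' := by exact_mod_cast hlen
  refine ⟨l', hl', ?_⟩
  have := sum_hilbert_pascal e n d (by omega)
  rw [← e₁, ← e₀, hlen] at this
  push_cast at this
  linarith

lemma HasModuleHilbertCoeffs.length_eq [IsNoetherianRing R] [Module.Finite R M] {e : ℕ → ℤ}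
    (h : HasModuleHilbertCoeffs R M 0 e) :
    ∃ l : ℕ, Module.length R M = l ∧ (l : ℤ) = e 0 := by
  obtain ⟨N, hN⟩ := h
  obtain ⟨l₁, h₁, e₁⟩ := hN N le_rfl
  obtain ⟨l₂, h₂, e₂⟩ := hN (N + 1) (by omega)
  simp only [zero_add, sum_range_one, pow_zero, one_mul, add_zero, tsub_zero, Nat.choose_zero_right,
    Nat.cast_one, mul_one] at e₁ e₂
  obtain rfl : l₁ = l₂ := by exact_mod_cast e₁.trans e₂.symm
  have hle : (maximalIdeal R ^ (N + 1 + 1) • ⊤ : Submodule R M) ≤ maximalIdeal R ^ (N + 1) • ⊤ :=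
    Submodule.smul_mono_left (Ideal.pow_le_pow_right (by omega))
  have hbot : (maximalIdeal R ^ (N + 1) • ⊤ : Submodule R M) = ⊥ := by
    have hfac := Submodule.factor_surjective hle
    have hadd := Module.length_eq_add_of_exact (LinearMap.ker (Submodule.factor hle)).subtype
      (Submodule.factor hle) (Submodule.subtype_injective _) hfac
      (LinearMap.exact_subtype_ker_map _)
    rw [h₁, h₂] at hadd
    have hker : Module.length R (LinearMap.ker (Submodule.factor hle)) = 0 := by
      revert hadd
      generalize Module.length R (LinearMap.ker (Submodule.factor hle)) = a
      cases a with
      | top => simp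
      | coe a => intro hadd; norm_cast at hadd ⊢; omega
    rw [Module.length_eq_zero_iff, Submodule.subsingleton_iff_eq_bot] at hker
    refine Submodule.eq_bot_of_le_smul_of_le_jacobson_bot (maximalIdeal R) _
      (IsNoetherian.noetherian _) ?_ (maximalIdeal_le_jacobson _)
    rw [← Submodule.mul_smul, ← pow_succ']
    intro u hu
    have : Submodule.Quotient.mk u ∈ LinearMap.ker (Submodule.factor hle) := by
      rw [LinearMap.mem_ker]
      exact (Submodule.Quotient.mk_eq_zero _).mpr hu
    rw [hker, Submodule.mem_bot, Submodule.Quotient.mk_eq_zero] at this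
    exact this
  refine ⟨l₁, ?_, e₁⟩
  rw [← h₁, hbot]
  exact (Submodule.quotEquivOfEqBot _ rfl).length_eq.symm

lemma hasModuleHilbertCoeffs_zero [IsNoetherianRing R] [Module.Finite R M] {l : ℕ}
    (h : Module.length R M = l) : HasModuleHilbertCoeffs R M 0 fun _ => l := by
  have hfl : IsFiniteLength R M := Module.length_ne_top_iff.mp (by simp [h])
  have : IsArtinian R M := (isFiniteLength_iff_isNoetherian_isArtinian.mp hfl).2
  obtain ⟨N, hN⟩ : ∃ N, (maximalIdeal R ^ N • ⊤ : Submodule R M) =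
      maximalIdeal R ^ (N + 1) • ⊤ := by
    obtain ⟨N, hN⟩ := IsArtinian.monotone_stabilizes
      (⟨fun n => OrderDual.toDual (maximalIdeal R ^ n • ⊤ : Submodule R M), fun a b hab =>
        Submodule.smul_mono_left (Ideal.pow_le_pow_right hab)⟩ : ℕ →o (Submodule R M)ᵒᵈ)
    exact ⟨N, congrArg OrderDual.ofDual (hN (N + 1) (by omega))⟩
  have hbot : (maximalIdeal R ^ N • ⊤ : Submodule R M) = ⊥ := by
    refine Submodule.eq_bot_of_le_smul_of_le_jacobson_bot (maximalIdeal R) _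
      (IsNoetherian.noetherian _) ?_ (maximalIdeal_le_jacobson _)
    rw [← Submodule.mul_smul, ← pow_succ']
    exact hN.le
  refine ⟨N, fun n hn => ⟨l, ?_, by simp⟩⟩
  have : (maximalIdeal R ^ (n + 1) • ⊤ : Submodule R M) = ⊥ :=
    le_bot_iff.mp ((Submodule.smul_mono_left (Ideal.pow_le_pow_right (by omega))).trans hbot.le)
  rw [← h, this]
  exact (Submodule.quotEquivOfEqBot _ rfl).length_eq

end HilbertCoeffs

section Superficial

open Polynomial

namespace reesAlgebra

variable {R : Type*} [CommRing R] (J : Ideal R)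

/-- The ideal of elements `a` such that `aX` is an element of the given ideal of the
Rees algebra. -/
noncomputable def degreeOnePart (P : Ideal (reesAlgebra J)) : Ideal R :=
  Submodule.comap (monomial 1 : R →ₗ[R] R[X])
    ((P.restrictScalars R).map (reesAlgebra J).val.toLinearMap)

variable {J}

lemma mem_degreeOnePart {P : Ideal (reesAlgebra J)} {a : R} (ha : monomial 1 a ∈ reesAlgebra J) :
    a ∈ degreeOnePart J P ↔ (⟨monomial 1 a, ha⟩ : reesAlgebra J) ∈ P := by
  constructor
  · rintro ⟨y, hy, hya⟩
    convert (show y ∈ P from hy) using 1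
    exact Subtype.ext hya.symm
  · intro h
    exact ⟨_, h, rfl⟩

lemma monomial_one_mem {a : R} (ha : a ∈ J) : monomial 1 a ∈ reesAlgebra J :=
  reesAlgebra.monomial_mem.mpr (by simpa using ha)

variable (J) in
/-- The ideal of the Rees algebra generated by its degree one elements. -/
noncomputable def degreeOneIdeal : Ideal (reesAlgebra J) :=
  Ideal.span {f | ∃ a ∈ J, (f : R[X]) = monomial 1 a}

lemma monomial_mem_degreeOneIdeal_pow {c : ℕ} {a : R} (ha : a ∈ J ^ c) :
    (⟨monomial c a, reesAlgebra.monomial_mem.mpr ha⟩ : reesAlgebra J) ∈ degreeOneIdeal J ^ c := by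
  suffices h : ∃ f ∈ degreeOneIdeal J ^ c, (f : R[X]) = monomial c a by
    obtain ⟨f, hf, hfa⟩ := h
    convert hf
    exact hfa.symm
  induction c generalizing a with
  | zero => exact ⟨⟨monomial 0 a, reesAlgebra.monomial_mem.mpr ha⟩, by simp, rfl⟩
  | succ c ih =>
    rw [pow_succ'] at ha
    refine Submodule.mul_induction_on ha ?_ ?_
    · intro b hb d hd
      obtain ⟨f, hf, hfd⟩ := ih hd
      refine ⟨⟨monomial 1 b, monomial_one_mem hb⟩ * f, ?_, ?_⟩
      · rw [pow_succ']
        exact Ideal.mul_mem_mul (Ideal.subset_span ⟨b, hb, rfl⟩) hf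
      · simp [hfd, monomial_mul_monomial, add_comm]
    · rintro x y ⟨f, hf, hfx⟩ ⟨f', hf', hfy⟩
      exact ⟨f + f', Ideal.add_mem _ hf hf', by simp [hfx, hfy]⟩

lemma degreeOneIdeal_le {P : Ideal (reesAlgebra J)} (h : J ≤ degreeOnePart J P) :
    degreeOneIdeal J ≤ P := by
  rw [degreeOneIdeal, Ideal.span_le]
  rintro ⟨f, hf⟩ ⟨a, ha, rfl⟩
  exact (mem_degreeOnePart hf).mp (h ha)

end reesAlgebra

/-- If `x` avoids the associated primes of `N` not containing an ideal `𝔞`, then some power of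
`𝔞` kills the elements of `N` killed by `x`. -/
lemma exists_pow_le_annihilator_torsionBy {T N : Type*} [CommRing T] [IsNoetherianRing T]
    [AddCommGroup N] [Module T N] [Module.Finite T N] (𝔞 : Ideal T) (x : T)
    (hx : ∀ P ∈ associatedPrimes T N, x ∈ P → 𝔞 ≤ P) :
    ∃ c, ∀ f ∈ 𝔞 ^ c, ∀ z : N, x • z = 0 → f • z = 0 := by
  set K := Submodule.torsionBy T N x
  have hle : 𝔞 ≤ (Module.annihilator T K).radical := by
    rw [← Ideal.sInf_minimalPrimes]
    refine le_sInf fun P hP => ?_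
    have hxP : x ∈ P := hP.1.2 (Module.mem_annihilator.mpr fun z => Subtype.ext z.2)
    have hass := Module.associatedPrimes.minimalPrimes_annihilator_subset_associatedPrimes T K hP
    exact hx P (associatedPrimes.subset_of_injective K.subtype_injective hass) hxP
  obtain ⟨c, hc⟩ := Ideal.exists_pow_le_of_le_radical_of_fg hle (IsNoetherian.noetherian _)
  refine ⟨c, fun f hf z hz => ?_⟩
  have := Module.mem_annihilator.mp (hc hf) ⟨z, (Submodule.mem_torsionBy_iff _ _).mpr hz⟩
  exact congrArg Subtype.val this

open PolynomialModule in
lemma Ideal.exists_finite_forall_superficial {R : Type*} [CommRing R] [IsNoetherianRing R]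
    (J : Ideal R) (M : Type*) [AddCommGroup M] [Module R M] [Module.Finite R M] :
    ∃ 𝒱 : Set (Ideal R), 𝒱.Finite ∧ (∀ V ∈ 𝒱, ¬ J ≤ V) ∧ ∀ x ∈ J, (∀ V ∈ 𝒱, x ∉ V) →
      ∃ n₀, ∀ n ≥ n₀, ∀ u ∈ (J ^ n • ⊤ : Submodule R M),
        x • u ∈ (J ^ (n + 2) • ⊤ : Submodule R M) → u ∈ (J ^ (n + 1) • ⊤ : Submodule R M) := by
  let F : J.Filtration M := J.stableFiltration ⊤
  have hF : F.Stable := J.stableFiltration_stable ⊤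
  let F' : J.Filtration M :=
    { N := fun i => J ^ (i + 1) • ⊤
      mono := fun i => F.mono (i + 1)
      smul_le := fun i => F.smul_le (i + 1) }
  let G : Submodule (reesAlgebra J) (PolynomialModule R M ⧸ F'.submodule) :=
    F.submodule.map F'.submodule.mkQ
  have hG : Module.Finite (reesAlgebra J) G := Module.Finite.iff_fg.mpr
    (((F.submodule_fg_iff_stable fun _ => IsNoetherian.noetherian _).mpr hF).map _)
  refine ⟨{V | ∃ P ∈ associatedPrimes (reesAlgebra J) G, ¬ J ≤ V ∧
    V = reesAlgebra.degreeOnePart J P}, ?_, ?_, ?_⟩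
  · refine ((associatedPrimes.finite (reesAlgebra J) G).image
      (reesAlgebra.degreeOnePart J)).subset ?_
    rintro V ⟨P, hP, -, rfl⟩
    exact ⟨P, hP, rfl⟩
  · rintro V ⟨P, hP, h, rfl⟩
    exact h
  intro x hxJ hx
  obtain ⟨c, hc⟩ := exists_pow_le_annihilator_torsionBy (N := G) (reesAlgebra.degreeOneIdeal J)
    ⟨monomial 1 x, reesAlgebra.monomial_one_mem hxJ⟩ (fun P hP hxP => by
      refine reesAlgebra.degreeOneIdeal_le ?_
      by_contra hJ
      exact hx _ ⟨P, hP, hJ, rfl⟩ ((reesAlgebra.mem_degreeOnePart _).mpr hxP))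
  let K : J.Filtration M :=
    { N := fun i => F.N i ⊓ (F.N (i + 2)).comap (LinearMap.lsmul R M x)
      mono := fun i => inf_le_inf (F.mono i) (Submodule.comap_mono (F.mono (i + 2)))
      smul_le := fun i => by
        rw [Submodule.smul_le]
        rintro r hr u ⟨hu, hu'⟩
        refine ⟨F.smul_le i (Submodule.smul_mem_smul hr hu), ?_⟩
        simp only [SetLike.mem_coe, Submodule.mem_comap, LinearMap.lsmul_apply] at hu' ⊢
        rw [smul_comm]
        exact F.smul_le (i + 2) (Submodule.smul_mem_smul hr hu') }
  have hK : K.Stable := hF.of_le fun i => inf_le_left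
  obtain ⟨n₀, hn₀⟩ := hK.exists_pow_smul_eq
  have hkill : J ^ c • K.N n₀ ≤ J ^ (n₀ + c + 1) • ⊤ := by
    rw [Submodule.smul_le]
    rintro a ha u ⟨hu, hu'⟩
    have hmem : ∀ (i : ℕ) (v : M) (L : J.Filtration M), v ∈ L.N i →
        single R i v ∈ L.submodule := by
      intro i v L hv
      rw [← L.submodule_span_single]
      exact Submodule.subset_span (Set.mem_iUnion.mpr ⟨i, v, hv, rfl⟩)
    let z : G := ⟨F'.submodule.mkQ (single R n₀ u),
      Submodule.mem_map_of_mem (hmem n₀ u F hu)⟩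
    have hz := hc ⟨monomial c a, reesAlgebra.monomial_mem.mpr ha⟩
      (reesAlgebra.monomial_mem_degreeOneIdeal_pow ha) z (by
        refine Subtype.ext ((Submodule.Quotient.mk_eq_zero _).mpr ?_)
        change monomial 1 x • single R n₀ u ∈ F'.submodule
        rw [monomial_smul_single, add_comm]
        exact hmem _ _ F' hu')
    have hz := (Submodule.Quotient.mk_eq_zero _).mp (congrArg Subtype.val hz)
    change monomial c a • single R n₀ u ∈ F'.submodule at hz
    rw [monomial_smul_single, add_comm] at hz
    simpa using hz (n₀ + c)
  refine ⟨n₀ + c, fun n hn u hu hxu => ?_⟩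
  obtain ⟨k, rfl⟩ := Nat.exists_eq_add_of_le hn
  have hu' : u ∈ K.N (n₀ + (c + k)) := by
    rw [← add_assoc]
    exact ⟨hu, hxu⟩
  rw [hn₀, add_comm c k, pow_add, Submodule.mul_smul] at hu'
  have := Submodule.smul_mono le_rfl hkill hu'
  rwa [← Submodule.mul_smul, ← pow_add, show k + (n₀ + c + 1) = n₀ + c + k + 1 by omega] at this

open Pointwise in
/-- A nonzerodivisor satisfying the graded superficiality condition is superficial. -/
lemma isSuperficialOn_of_forall {R : Type*} [CommRing R] [IsNoetherianRing R] [IsLocalRing R]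
    {M : Type*} [AddCommGroup M] [Module R M] [Module.Finite R M] {x : R}
    (hx : IsSMulRegular M x)
    (h : ∃ n₀, ∀ n ≥ n₀, ∀ u ∈ (maximalIdeal R ^ n • ⊤ : Submodule R M),
      x • u ∈ (maximalIdeal R ^ (n + 2) • ⊤ : Submodule R M) →
      u ∈ (maximalIdeal R ^ (n + 1) • ⊤ : Submodule R M)) : IsSuperficialOn M x := by
  refine ⟨hx, ?_⟩
  obtain ⟨n₀, hn₀⟩ := h
  obtain ⟨k, hk⟩ := (maximalIdeal R).exists_pow_inf_eq_pow_smul (x • (⊤ : Submodule R M))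
  refine ⟨n₀ + k, fun n hn u hu => ?_⟩
  have hstart : u ∈ (maximalIdeal R ^ (n + 1 - k) • ⊤ : Submodule R M) := by
    have h1 : x • u ∈ maximalIdeal R ^ (n + 1 - k) • (maximalIdeal R ^ k • ⊤ ⊓
        x • (⊤ : Submodule R M)) := by
      rw [← hk _ (by omega)]
      exact ⟨hu, Submodule.smul_mem_pointwise_smul u x _ trivial⟩
    have h2 : x • u ∈ maximalIdeal R ^ (n + 1 - k) • (x • (⊤ : Submodule R M)) :=
      Submodule.smul_mono le_rfl inf_le_right h1
    rw [← Submodule.ideal_span_singleton_smul, ← Submodule.mul_smul, mul_comm, Submodule.mul_smul,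
      Submodule.ideal_span_singleton_smul] at h2
    obtain ⟨v, hv, hvu⟩ := (Submodule.mem_smul_pointwise_iff_exists _ _ _).mp h2
    rwa [← hx hvu]
  have hmono : ∀ {i j : ℕ}, i ≤ j → (maximalIdeal R ^ j • ⊤ : Submodule R M) ≤
      maximalIdeal R ^ i • ⊤ := fun hij => Submodule.smul_mono_left (Ideal.pow_le_pow_right hij)
  have hind : ∀ j, n₀ ≤ j → j ≤ n → u ∈ (maximalIdeal R ^ j • ⊤ : Submodule R M) := by
    intro j hj
    induction j, hj using Nat.le_induction with
    | base => intro _; exact hmono (by omega) hstart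
    | succ j hj ih => intro hjn; exact hn₀ j hj u (ih (by omega)) (hmono (by omega) hu)
  exact hind n (by omega) le_rfl

end Superficial

section Avoidance

variable {R : Type*} [CommRing R] [IsNoetherianRing R] [IsLocalRing R]

/-- Finitely many ideals not containing the maximal ideal are avoided by some element of the
maximal ideal if the residue field is infinite. -/
lemma exists_mem_maximalIdeal_forall_notMem [Infinite (ResidueField R)] {𝒱 : Set (Ideal R)}
    (hfin : 𝒱.Finite) (h : ∀ V ∈ 𝒱, ¬ maximalIdeal R ≤ V) :
    ∃ x ∈ maximalIdeal R, ∀ V ∈ 𝒱, x ∉ V := by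
  let W (V : Ideal R) : Subspace (ResidueField R) (CotangentSpace R) :=
    { carrier := {y | ∃ a : maximalIdeal R, a.1 ∈ V ∧ (maximalIdeal R).toCotangent a = y}
      add_mem' := by
        rintro _ _ ⟨a, ha, rfl⟩ ⟨b, hb, rfl⟩
        exact ⟨a + b, V.add_mem ha hb, map_add _ _ _⟩
      zero_mem' := ⟨0, V.zero_mem, map_zero _⟩
      smul_mem' := by
        rintro c _ ⟨a, ha, rfl⟩
        obtain ⟨r, rfl⟩ := residue_surjective c
        exact ⟨r • a, V.mul_mem_left r ha, map_smul _ r a⟩ }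
  by_contra! hcon
  have : Finite 𝒱 := hfin
  obtain ⟨V, hV⟩ := Subspace.exists_eq_top_of_iUnion_eq_univ (p := fun V : 𝒱 => W V.1) (by
    refine Set.eq_univ_of_forall fun y => ?_
    obtain ⟨a, rfl⟩ := (maximalIdeal R).toCotangent_surjective y
    obtain ⟨V, hV, haV⟩ := hcon a.1 a.2
    exact Set.mem_iUnion.mpr ⟨⟨V, hV⟩, a, haV, rfl⟩)
  refine h V.1 V.2 ?_
  refine Submodule.le_of_le_smul_of_le_jacobson_bot (I := maximalIdeal R)
    (IsNoetherian.noetherian _) (maximalIdeal_le_jacobson _) fun a ha => ?_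
  have hmem : (maximalIdeal R).toCotangent ⟨a, ha⟩ ∈ W V.1 := hV ▸ Submodule.mem_top
  obtain ⟨b, hb, hab⟩ := hmem
  rw [Ideal.toCotangent_eq, sq] at hab
  rw [← sub_sub_cancel b.1 a]
  exact Submodule.sub_mem _ (Submodule.mem_sup_left hb) (Submodule.mem_sup_right hab)

lemma exists_finite_forall_isSuperficialOn (M : Type*) [AddCommGroup M] [Module R M]
    [Module.Finite R M] (hM : ∃ y ∈ maximalIdeal R, IsSMulRegular M y) :
    ∃ 𝒱 : Set (Ideal R), 𝒱.Finite ∧ (∀ V ∈ 𝒱, ¬ maximalIdeal R ≤ V) ∧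
      ∀ x ∈ maximalIdeal R, (∀ V ∈ 𝒱, x ∉ V) → IsSuperficialOn M x := by
  obtain ⟨𝒱, hfin, hV, h⟩ := (maximalIdeal R).exists_finite_forall_superficial M
  obtain ⟨y, hym, hy⟩ := hM
  have hreg (x : R) : IsSMulRegular M x ↔ ∀ p ∈ associatedPrimes R M, x ∉ p := by
    have := Set.ext_iff.mp (biUnion_associatedPrimes_eq_compl_regular R M) x
    simp only [Set.mem_iUnion, SetLike.mem_coe, Set.mem_compl_iff, Set.mem_ofPred_eq] at this
    rw [← not_iff_not, ← this]
    push Not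
    simp
  refine ⟨𝒱 ∪ associatedPrimes R M, hfin.union (associatedPrimes.finite R M), ?_, ?_⟩
  · rintro V (hV' | hV') hle
    · exact hV V hV' hle
    · exact (hreg y).mp hy V hV' (hle hym)
  · intro x hxm hx
    exact isSuperficialOn_of_forall ((hreg x).mpr fun p hp => hx p (Or.inr hp))
      (h x hxm fun V hV => hx V (Or.inl hV))

lemma exists_isSuperficialOn_and_isSuperficialOn [Infinite (ResidueField R)]
    (M N : Type*) [AddCommGroup M] [Module R M] [Module.Finite R M] [AddCommGroup N] [Module R N]
    [Module.Finite R N] (hM : ∃ y ∈ maximalIdeal R, IsSMulRegular M y)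
    (hN : ∃ y ∈ maximalIdeal R, IsSMulRegular N y) :
    ∃ x ∈ maximalIdeal R, IsSuperficialOn M x ∧ IsSuperficialOn N x := by
  obtain ⟨𝒱, h1, h2, h3⟩ := exists_finite_forall_isSuperficialOn M hM
  obtain ⟨𝒲, h4, h5, h6⟩ := exists_finite_forall_isSuperficialOn N hN
  obtain ⟨x, hxm, hx⟩ := exists_mem_maximalIdeal_forall_notMem (h1.union h4)
    (fun V hV => hV.elim (h2 V) (h5 V))
  exact ⟨x, hxm, h3 x hxm fun V hV => hx V (Or.inl hV), h6 x hxm fun V hV => hx V (Or.inr hV)⟩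

end Avoidance

section Generators

open Pointwise

/-- `N` is generated by at most `b` elements. -/
def IsGeneratedByLE {R M : Type*} [CommRing R] [AddCommGroup M] [Module R M] (N : Submodule R M)
    (b : ℤ) : Prop :=
  ∃ s : Finset M, Submodule.span R (s : Set M) = N ∧ (s.card : ℤ) ≤ b

variable {R : Type*} [CommRing R] {M M' : Type*} [AddCommGroup M] [Module R M] [AddCommGroup M']
  [Module R M']

lemma isGeneratedByLE_bot : IsGeneratedByLE (⊥ : Submodule R M) 0 := ⟨∅, by simp, by simp⟩

lemma IsGeneratedByLE.mono {N : Submodule R M} {a b : ℤ} (h : IsGeneratedByLE N a) (hab : a ≤ b) :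
    IsGeneratedByLE N b :=
  let ⟨s, hs, hc⟩ := h
  ⟨s, hs, hc.trans hab⟩

lemma IsGeneratedByLE.map {N : Submodule R M} {b : ℤ} (h : IsGeneratedByLE N b) (f : M →ₗ[R] M') :
    IsGeneratedByLE (N.map f) b := by
  classical
  obtain ⟨s, rfl, hs⟩ := h
  refine ⟨s.image f, by rw [Submodule.map_span, Finset.coe_image], le_trans ?_ hs⟩
  exact_mod_cast Finset.card_image_le

lemma IsGeneratedByLE.exists_map_eq {N : Submodule R M} {f : M →ₗ[R] M'} {b : ℤ}
    (h : IsGeneratedByLE (N.map f) b) :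
    ∃ K ≤ N, IsGeneratedByLE K b ∧ K.map f = N.map f := by
  classical
  obtain ⟨s, hs, hc⟩ := h
  have hsub : ∀ y : s, ∃ u ∈ N, f u = y := fun y =>
    (hs ▸ Submodule.subset_span y.2 : (y : M') ∈ N.map f)
  choose g hg hfg using hsub
  refine ⟨_, ?_, ⟨s.attach.image g, rfl, ?_⟩, ?_⟩
  · rw [Submodule.span_le]
    intro u hu
    obtain ⟨y, -, rfl⟩ := Finset.mem_image.mp (Finset.mem_coe.mp hu)
    exact hg y
  · have := (s.attach.card_image_le (f := g)).trans_eq s.card_attach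
    omega
  · rw [← hs, Submodule.map_span]
    congr 1
    ext y
    simp [hfg]

lemma IsGeneratedByLE.sup {N K : Submodule R M} {a b : ℤ} (hN : IsGeneratedByLE N a)
    (hK : IsGeneratedByLE K b) : IsGeneratedByLE (N ⊔ K) (a + b) := by
  classical
  obtain ⟨s, rfl, hs⟩ := hN
  obtain ⟨t, rfl, ht⟩ := hK
  refine ⟨s ∪ t, by rw [Finset.coe_union, Submodule.span_union], ?_⟩
  have := Finset.card_union_le s t
  omega

lemma isGeneratedByLE_top_of_length_eq {l : ℕ} (h : Module.length R M = l) :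
    IsGeneratedByLE (⊤ : Submodule R M) l := by
  induction l using Nat.strong_induction_on generalizing M with | _ l ih =>
  rcases subsingleton_or_nontrivial M with hM | hM
  · rw [Subsingleton.elim (⊤ : Submodule R M) ⊥]
    exact isGeneratedByLE_bot.mono (by omega)
  obtain ⟨y, hy⟩ := exists_ne (0 : M)
  set Y := Submodule.span R {y}
  have hadd := Module.length_eq_add_of_exact Y.subtype Y.mkQ Y.subtype_injective
    Y.mkQ_surjective (LinearMap.exact_subtype_mkQ Y)
  have hpos : Module.length R Y ≠ 0 := by
    rw [Ne, Module.length_eq_zero_iff, Submodule.subsingleton_iff_eq_bot]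
    simpa [Y] using hy
  rw [h] at hadd
  obtain ⟨l', hl'⟩ : ∃ l' : ℕ, Module.length R (M ⧸ Y) = l' :=
    ⟨_, (ENat.natCast_toNat fun htop => by simp [htop] at hadd).symm⟩
  obtain ⟨l'', hl''⟩ : ∃ l' : ℕ, Module.length R Y = l' :=
    ⟨_, (ENat.natCast_toNat fun htop => by simp [htop] at hadd).symm⟩
  rw [hl', hl''] at hadd
  rw [hl''] at hpos
  have hadd : l = l'' + l' := by exact_mod_cast hadd
  have hpos : l'' ≠ 0 := by exact_mod_cast hpos
  have hgen := ih l' (by omega) hl'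
  rw [← LinearMap.range_eq_top.mpr Y.mkQ_surjective, ← Submodule.map_top] at hgen
  obtain ⟨K, -, hK, hmap⟩ := hgen.exists_map_eq
  have hY : IsGeneratedByLE Y 1 := ⟨{y}, by simp [Y], by simp⟩
  have htop : K ⊔ Y = ⊤ := by
    rw [eq_top_iff]
    intro u _
    obtain ⟨k, hk, hku⟩ : Y.mkQ u ∈ K.map Y.mkQ := hmap ▸ Submodule.mem_map_of_mem trivial
    rw [← add_sub_cancel k u]
    exact Submodule.add_mem_sup hk ((Submodule.Quotient.eq Y).mp hku.symm)
  rw [← htop]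
  exact (hK.sup hY).mono (by omega)

lemma isGeneratedByLE_of_length_eq {N : Submodule R M} {l : ℕ} (h : Module.length R N = l) :
    IsGeneratedByLE N l := by
  have := (isGeneratedByLE_top_of_length_eq h).map N.subtype
  rwa [Submodule.map_top, Submodule.range_subtype] at this

section Local

variable [IsNoetherianRing R] [IsLocalRing R] [Module.Finite R M]

lemma IsGeneratedByLE.of_map {N L : Submodule R M} {a b : ℤ} (f : M →ₗ[R] M')
    (hN : IsGeneratedByLE (N.map f) a) (hL : IsGeneratedByLE L b) (hLN : L ≤ N)
    (h : N ⊓ LinearMap.ker f ≤ L ⊔ maximalIdeal R • N) : IsGeneratedByLE N (a + b) := by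
  obtain ⟨K, hKN, hK, hmap⟩ := hN.exists_map_eq
  have hle : N ≤ K ⊔ L := by
    refine Submodule.le_of_le_smul_of_le_jacobson_bot (I := maximalIdeal R)
      (IsNoetherian.noetherian _) (maximalIdeal_le_jacobson _) fun u hu => ?_
    obtain ⟨k, hk, hku⟩ : f u ∈ K.map f := hmap ▸ Submodule.mem_map_of_mem hu
    have hsub : u - k ∈ L ⊔ maximalIdeal R • N :=
      h ⟨N.sub_mem hu (hKN hk), by simp [hku]⟩
    rw [sup_assoc, ← add_sub_cancel k u]
    exact Submodule.add_mem_sup hk hsub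
  rw [hle.antisymm (sup_le hKN hLN)]
  exact hK.sup hL

end Local

end Generators

section Bound

open Pointwise

universe u

variable {R : Type u} [CommRing R] {A Q : Type u} [AddCommGroup A] [Module R A]
  [AddCommGroup Q] [Module R Q]

/-- The map induced by `π` on the quotients by `x`. -/
def quotSMulTopMap (x : R) (π : A →ₗ[R] Q) : QuotSMulTop x A →ₗ[R] QuotSMulTop x Q :=
  Submodule.mapQ _ _ π <| by
    rw [← Submodule.map_le_iff_le_comap, Submodule.map_pointwise_smul]
    exact smul_mono_right x le_top

lemma quotSMulTopMap_surjective (x : R) {π : A →ₗ[R] Q} (hπ : Function.Surjective π) :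
    Function.Surjective (quotSMulTopMap x π) := by
  intro u
  induction u using Submodule.Quotient.induction_on with | _ u =>
  obtain ⟨v, rfl⟩ := hπ u
  exact ⟨Submodule.Quotient.mk v, rfl⟩

lemma ker_quotSMulTopMap (x : R) {π : A →ₗ[R] Q} (hπ : Function.Surjective π) :
    LinearMap.ker (quotSMulTopMap x π) =
      (LinearMap.ker π).map (x • (⊤ : Submodule R A)).mkQ := by
  ext u
  induction u using Submodule.Quotient.induction_on with | _ u =>
  constructor
  · intro hu
    obtain ⟨v, -, hv⟩ := (Submodule.mem_smul_pointwise_iff_exists _ _ _).mp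
      ((Submodule.Quotient.mk_eq_zero _).mp hu)
    obtain ⟨w, rfl⟩ := hπ v
    refine ⟨u - x • w, by simp [hv], (Submodule.Quotient.eq _).mpr ?_⟩
    rw [sub_sub_cancel_left, neg_mem_iff]
    exact Submodule.smul_mem_pointwise_smul _ _ _ trivial
  · rintro ⟨v, hv, hvu⟩
    have : quotSMulTopMap x π (Submodule.Quotient.mk v) = 0 :=
      congrArg Submodule.Quotient.mk hv
    rwa [← hvu]

/-- `K ⧸ I`, where `K = (I : x)` and `A ⧸ I ≅ Q`, is a submodule of `Q`; so `K` is generated modulo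
`I` by at most `λ(Q)` elements. -/
lemma exists_isGeneratedByLE_smul_inf_le {π : A →ₗ[R] Q}
    {l : ℕ} (hl : Module.length R Q = l) (x : R) :
    ∃ L ≤ LinearMap.ker π, IsGeneratedByLE L l ∧
      LinearMap.ker π ⊓ x • (⊤ : Submodule R A) ≤ L ⊔ x • LinearMap.ker π := by
  set K : Submodule R A := (LinearMap.ker π).comap (LinearMap.lsmul R A x)
  have hle : Module.length R (K.map π) ≤ l := hl ▸ Module.length_le_of_injective
    (K.map π).subtype (Submodule.subtype_injective _)
  obtain ⟨l', hl'⟩ : ∃ l' : ℕ, Module.length R (K.map π) = l' :=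
    ⟨_, (ENat.natCast_toNat fun htop => by simp [htop] at hle).symm⟩
  have hgen : IsGeneratedByLE (K.map π) l := (isGeneratedByLE_of_length_eq hl').mono (by
    rw [hl'] at hle
    exact_mod_cast hle)
  obtain ⟨T, hTK, hT, hmap⟩ := hgen.exists_map_eq
  refine ⟨T.map (LinearMap.lsmul R A x), Submodule.map_le_iff_le_comap.mpr hTK, hT.map _, ?_⟩
  rintro _ ⟨hu, hu'⟩
  obtain ⟨v, -, rfl⟩ := (Submodule.mem_smul_pointwise_iff_exists _ _ _).mp hu'
  have hvK : v ∈ K := hu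
  obtain ⟨t, ht, htv⟩ : π v ∈ T.map π := hmap ▸ Submodule.mem_map_of_mem hvK
  rw [← add_sub_cancel t v, smul_add]
  refine Submodule.add_mem_sup ⟨t, ht, rfl⟩ (Submodule.smul_mem_pointwise_smul _ _ _ ?_)
  simp [htv]

/-- If `x` is `A`-regular and `Q ≅ A ⧸ I` has finite length, `λ(I ⧸ xI) = λ(A ⧸ xA)`. -/
lemma length_map_ker_mkQ_smul {π : A →ₗ[R] Q} (hπ : Function.Surjective π)
    {l : ℕ} (hl : Module.length R Q = l) {x : R} (hx : IsSMulRegular A x) :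
    Module.length R ((LinearMap.ker π).map (x • LinearMap.ker π).mkQ) =
      Module.length R (QuotSMulTop x A) := by
  set I := LinearMap.ker π
  have hxI : x • I ≤ I := Submodule.smul_le_self_of_tower x I
  let f₁ : (A ⧸ I) →ₗ[R] A ⧸ x • I := Submodule.mapQ _ _ (LinearMap.lsmul R A x)
    fun u hu => Submodule.smul_mem_pointwise_smul u x I hu
  have h₁ := Module.length_eq_add_of_exact f₁
    (Submodule.factor (smul_mono_right x (le_top (a := I)))) (by
      rw [← LinearMap.ker_eq_bot, LinearMap.ker_eq_bot']
      intro u hu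
      induction u using Submodule.Quotient.induction_on with | _ u =>
      obtain ⟨v, hv, hvu⟩ := (Submodule.mem_smul_pointwise_iff_exists _ _ _).mp
        ((Submodule.Quotient.mk_eq_zero _).mp hu)
      rw [Submodule.Quotient.mk_eq_zero]
      rwa [← hx hvu]) (Submodule.factor_surjective _) (by
      intro u
      induction u using Submodule.Quotient.induction_on with | _ u =>
      constructor
      · intro hu
        obtain ⟨v, -, rfl⟩ := (Submodule.mem_smul_pointwise_iff_exists _ _ _).mp
          ((Submodule.Quotient.mk_eq_zero _).mp hu)
        exact ⟨Submodule.Quotient.mk v, rfl⟩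
      · rintro ⟨v, hv⟩
        induction v using Submodule.Quotient.induction_on with | _ v =>
        rw [← hv]
        exact (Submodule.Quotient.mk_eq_zero _).mpr
          (Submodule.smul_mem_pointwise_smul v x ⊤ trivial))
  have h₂ := Module.length_eq_add_of_exact (I.map (x • I).mkQ).subtype (Submodule.factor hxI)
    (Submodule.subtype_injective _) (Submodule.factor_surjective _) (by
      intro u
      induction u using Submodule.Quotient.induction_on with | _ u =>
      constructor
      · intro hu
        exact ⟨⟨Submodule.Quotient.mk u, u, (Submodule.Quotient.mk_eq_zero _).mp hu, rfl⟩, rfl⟩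
      · rintro ⟨⟨_, v, hv, rfl⟩, hvu⟩
        rw [← hvu]
        exact (Submodule.Quotient.mk_eq_zero _).mpr hv)
  have h₃ : Module.length R (A ⧸ I) = l := by
    rw [← hl]
    exact (π.quotKerEquivOfSurjective hπ).length_eq
  rw [h₁, h₃, add_comm] at h₂
  exact (ENat.add_left_injective_of_ne_top (ENat.natCast_ne_top l) h₂).symm

variable [IsNoetherianRing R] [IsLocalRing R] [Infinite (ResidueField R)]

/-- The bound on the number of generators when the residue field is infinite. -/
theorem isGeneratedByLE_ker_of_infinite_residueField {d : ℕ} :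
    ∀ {q : ℕ} {A Q : Type u} [AddCommGroup A] [Module R A] [Module.Finite R A] [AddCommGroup Q]
      [Module R Q] [Module.Finite R Q] {π : A →ₗ[R] Q}, Function.Surjective π →
      HasRegularSeqOfLength R A d → HasRegularSeqOfLength R Q q → q < d →
      ∀ {e e' : ℕ → ℤ}, HasModuleHilbertCoeffs R A d e → HasModuleHilbertCoeffs R Q q e' →
      IsGeneratedByLE (LinearMap.ker π) (e 0 + ((d : ℤ) - q - 1) * e' 0) := by
  induction d with
  | zero => intro q; omega
  | succ d ih =>
    intro q A Q _ _ _ _ _ _ π hπ hA hQ hqd e e' he he'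
    have hsmul : ∀ {x : R}, x ∈ maximalIdeal R →
        x • LinearMap.ker π ≤ maximalIdeal R • LinearMap.ker π := by
      intro x hx
      rw [← Submodule.ideal_span_singleton_smul]
      exact Submodule.smul_mono_left ((Ideal.span_singleton_le_iff_mem _).mpr hx)
    have hA₁ : ∃ y ∈ maximalIdeal R, IsSMulRegular A y :=
      let ⟨y, hy, hy', _⟩ := hA.exists_cons; ⟨y, hy, hy'⟩
    cases q with
    | succ q =>
      have hQ₁ : ∃ y ∈ maximalIdeal R, IsSMulRegular Q y :=
        let ⟨y, hy, hy', _⟩ := hQ.exists_cons; ⟨y, hy, hy'⟩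
      obtain ⟨x, hxm, hxA, hxQ⟩ := exists_isSuperficialOn_and_isSuperficialOn A Q hA₁ hQ₁
      have hgen := ih (quotSMulTopMap_surjective x hπ) (hA.quotSMulTop hxm hxA.1)
        (hQ.quotSMulTop hxm hxQ.1) (by omega) (he.quotSMulTop hxm hxA) (he'.quotSMulTop hxm hxQ)
      rw [ker_quotSMulTopMap x hπ] at hgen
      refine (IsGeneratedByLE.of_map _ hgen isGeneratedByLE_bot bot_le ?_).mono (by
        push_cast
        linarith)
      rw [bot_sup_eq, Submodule.ker_mkQ]
      rintro _ ⟨hu, hu'⟩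
      obtain ⟨v, -, rfl⟩ := (Submodule.mem_smul_pointwise_iff_exists _ _ _).mp hu'
      refine hsmul hxm (Submodule.smul_mem_pointwise_smul _ _ _ (hxQ.1 ?_))
      simpa using hu
    | zero =>
      obtain ⟨x, hxm, hxA, -⟩ := exists_isSuperficialOn_and_isSuperficialOn A A hA₁ hA₁
      obtain ⟨l, hl, hle⟩ := he'.length_eq
      have heA := he.quotSMulTop hxm hxA
      cases d with
      | zero =>
        obtain ⟨l', hl', hle'⟩ := heA.length_eq
        have hgen := isGeneratedByLE_of_length_eq
          ((length_map_ker_mkQ_smul hπ hl hxA.1).trans hl')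
        refine (IsGeneratedByLE.of_map _ hgen isGeneratedByLE_bot bot_le ?_).mono (by simp [hle'])
        rw [bot_sup_eq, Submodule.ker_mkQ]
        exact inf_le_right.trans (hsmul hxm)
      | succ d =>
        have hle₁ : Module.length R (QuotSMulTop x Q) ≤ l :=
          hl ▸ Module.length_le_of_surjective _ (Submodule.mkQ_surjective _)
        obtain ⟨l', hl'⟩ : ∃ l' : ℕ, Module.length R (QuotSMulTop x Q) = l' :=
          ⟨_, (ENat.natCast_toNat fun htop => by simp [htop] at hle₁).symm⟩
        rw [hl'] at hle₁
        have hle₂ : (l' : ℤ) ≤ e' 0 := by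
          rw [← hle]
          exact_mod_cast hle₁
        have := hQ.nontrivial
        have : Nontrivial (QuotSMulTop x Q) := nontrivial_quotSMulTop_of_mem_maximalIdeal Q hxm
        have hgen := ih (q := 0) (quotSMulTopMap_surjective x hπ) (hA.quotSMulTop hxm hxA.1)
          ⟨[], rfl, by simp, RingTheory.Sequence.IsRegular.nil R _⟩ (by omega) heA
          (hasModuleHilbertCoeffs_zero hl')
        rw [ker_quotSMulTopMap x hπ] at hgen
        obtain ⟨L, hL, hLgen, hLle⟩ := exists_isGeneratedByLE_smul_inf_le (π := π) hl x
        refine (IsGeneratedByLE.of_map _ hgen hLgen hL ?_).mono ?_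
        · rw [Submodule.ker_mkQ]
          exact hLle.trans (sup_le_sup_left (hsmul hxm) _)
        · push_cast
          nlinarith [mul_le_mul_of_nonneg_left hle₂ (Int.natCast_nonneg d)]

end Bound

section BaseChange

open TensorProduct

section Generic

variable {R S : Type*} [CommRing R] [CommRing S] [Algebra R S]
  {M M' : Type*} [AddCommGroup M] [Module R M] [AddCommGroup M'] [Module R M']

lemma map_smul_top_eq_baseChange (J : Ideal R) :
    (J.map (algebraMap R S) • ⊤ : Submodule S (S ⊗[R] M)) =
      (J • ⊤ : Submodule R M).baseChange S := by
  apply le_antisymm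
  · rw [Ideal.map, ← Submodule.span_univ, Submodule.span_smul_span, Submodule.span_le]
    rintro _ ⟨_, ⟨r, hr, rfl⟩, z, -, rfl⟩
    simp only [SetLike.mem_coe]
    induction z using TensorProduct.induction_on with
    | zero => simp
    | tmul s m =>
      rw [algebraMap_smul, ← TensorProduct.tmul_smul]
      exact Submodule.tmul_mem_baseChange_of_mem _ (Submodule.smul_mem_smul hr trivial)
    | add a b ha hb =>
      rw [smul_add]
      exact add_mem ha hb
  · rw [Submodule.baseChange_eq_span, Submodule.span_le]
    rintro _ ⟨u, hu, rfl⟩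
    refine Submodule.smul_induction_on hu (fun r hr m _ => ?_) (fun a b ha hb => ?_)
    · rw [map_smul, ← algebraMap_smul S r]
      exact Submodule.smul_mem_smul (Ideal.mem_map_of_mem _ hr) trivial
    · rw [map_add]
      exact add_mem ha hb

lemma ker_baseChange_eq_baseChange_ker {f : M →ₗ[R] M'} (hf : Function.Surjective f) :
    LinearMap.ker (f.baseChange S) = (LinearMap.ker f).baseChange S := by
  ext u
  exact lTensor_exact S (LinearMap.exact_subtype_ker_map f) hf u

lemma baseChange_surjective {f : M →ₗ[R] M'} (hf : Function.Surjective f) :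
    Function.Surjective (f.baseChange S) :=
  LinearMap.lTensor_surjective S hf

/-- `S ⊗ M ⧸ J(S ⊗ M) ≅ S ⊗ (M ⧸ JM)`. -/
noncomputable def quotMapSMulTopEquiv (J : Ideal R) :
    ((S ⊗[R] M) ⧸ (J.map (algebraMap R S) • ⊤ : Submodule S (S ⊗[R] M))) ≃ₗ[S]
      S ⊗[R] (M ⧸ (J • ⊤ : Submodule R M)) :=
  (Submodule.quotEquivOfEq _ _ (by
    rw [map_smul_top_eq_baseChange, ker_baseChange_eq_baseChange_ker (Submodule.mkQ_surjective _),
      Submodule.ker_mkQ])).trans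
    (((J • ⊤ : Submodule R M).mkQ.baseChange S).quotKerEquivOfSurjective
      (baseChange_surjective (Submodule.mkQ_surjective _)))

end Generic

variable {R S : Type*} [CommRing R] [CommRing S] [IsLocalRing R] [IsLocalRing S] [Algebra R S]
  [IsLocalHom (algebraMap R S)] [Module.Flat R S]
  {M M' : Type*} [AddCommGroup M] [Module R M] [AddCommGroup M'] [Module R M']

lemma length_baseChange_of_map_eq (hS : (maximalIdeal R).map (algebraMap R S) = maximalIdeal S) :
    Module.length S (S ⊗[R] M) = Module.length R M := by
  rw [IsLocalRing.length_baseChange, hS]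
  have : IsSimpleModule S (S ⧸ maximalIdeal S) :=
    isSimpleModule_iff_quot_maximal.mpr ⟨_, inferInstance, ⟨LinearEquiv.refl _ _⟩⟩
  rw [Module.length_eq_one S (S ⧸ maximalIdeal S), mul_one]

lemma HasModuleHilbertCoeffs.baseChange
    (hS : (maximalIdeal R).map (algebraMap R S) = maximalIdeal S) {d : ℕ} {e : ℕ → ℤ}
    (h : HasModuleHilbertCoeffs R M d e) : HasModuleHilbertCoeffs S (S ⊗[R] M) d e := by
  obtain ⟨N, hN⟩ := h
  refine ⟨N, fun n hn => ?_⟩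
  obtain ⟨l, hl, hle⟩ := hN n hn
  refine ⟨l, ?_, hle⟩
  rw [← hl, ← length_baseChange_of_map_eq hS, ← hS, ← Ideal.map_pow]
  exact (quotMapSMulTopEquiv _).length_eq

lemma HasRegularSeqOfLength.baseChange {n : ℕ} (h : HasRegularSeqOfLength R M n) :
    HasRegularSeqOfLength S (S ⊗[R] M) n := by
  obtain ⟨rs, hl, hm, h⟩ := h
  have : Module.FaithfullyFlat R S := Module.FaithfullyFlat.of_flat_of_isLocalHom
  refine ⟨rs.map (algebraMap R S), by simpa using hl, fun r hr => ?_,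
    h.of_faithfullyFlat_of_isBaseChange (TensorProduct.isBaseChange R M S)⟩
  obtain ⟨a, ha, rfl⟩ := List.mem_map.mp hr
  have hle : (maximalIdeal R).map (algebraMap R S) ≤ maximalIdeal S :=
    ((local_hom_TFAE (algebraMap R S)).out 0 2).mp ‹IsLocalHom (algebraMap R S)›
  exact hle (Ideal.mem_map_of_mem _ (hm a ha))

lemma IsGeneratedByLE.top {R M : Type*} [CommRing R] [AddCommGroup M] [Module R M]
    {N : Submodule R M} {b : ℤ} (h : IsGeneratedByLE N b) :
    IsGeneratedByLE (⊤ : Submodule R N) b := by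
  have hN : (⊤ : Submodule R N).map N.subtype = N := by simp
  obtain ⟨K, -, hK, hmap⟩ := IsGeneratedByLE.exists_map_eq (hN.symm ▸ h)
  rwa [← Submodule.map_injective_of_injective N.subtype_injective hmap]

lemma IsGeneratedByLE.top_of_surjective {R M M' : Type*} [CommRing R] [AddCommGroup M] [Module R M]
    [AddCommGroup M'] [Module R M'] {b : ℤ} (h : IsGeneratedByLE (⊤ : Submodule R M) b)
    {f : M →ₗ[R] M'} (hf : Function.Surjective f) : IsGeneratedByLE (⊤ : Submodule R M') b := by
  rw [← LinearMap.range_eq_top.mpr hf, ← Submodule.map_top]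
  exact h.map f

/-- A module killed by the maximal ideal and generated by `b` elements has length at most `b`. -/
lemma length_le_of_isGeneratedByLE {R M : Type*} [CommRing R] [IsLocalRing R] [AddCommGroup M]
    [Module R M] {b : ℕ} (h : IsGeneratedByLE (⊤ : Submodule R M) b)
    (hM : (maximalIdeal R • ⊤ : Submodule R M) = ⊥) : Module.length R M ≤ b := by
  classical
  obtain ⟨s, hs, hc⟩ := h
  have hc : s.card ≤ b := by exact_mod_cast hc
  let f : (s → R ⧸ maximalIdeal R) →ₗ[R] M := LinearMap.lsum R (fun _ => R ⧸ maximalIdeal R) R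
    fun i => (maximalIdeal R).liftQ (LinearMap.toSpanSingleton R M i) fun r hr => by
      have : r • (i : M) ∈ (maximalIdeal R • ⊤ : Submodule R M) :=
        Submodule.smul_mem_smul hr trivial
      simpa [hM] using this
  have hf : Function.Surjective f := by
    rw [← LinearMap.range_eq_top, eq_top_iff, ← hs, Submodule.span_le]
    intro i hi
    refine ⟨Pi.single ⟨i, hi⟩ (Submodule.Quotient.mk 1), ?_⟩
    simp only [f, LinearMap.lsum_piSingle, Submodule.liftQ_apply,
      LinearMap.toSpanSingleton_apply, one_smul]
  have : IsSimpleModule R (R ⧸ maximalIdeal R) :=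
    isSimpleModule_iff_quot_maximal.mpr ⟨_, inferInstance, ⟨LinearEquiv.refl _ _⟩⟩
  refine (Module.length_le_of_surjective f hf).trans ?_
  rw [Module.length_pi, Module.length_eq_one R (R ⧸ maximalIdeal R), mul_one]
  simpa using hc

lemma IsGeneratedByLE.of_baseChange [IsNoetherianRing R] [Module.Finite R M]
    (hS : (maximalIdeal R).map (algebraMap R S) = maximalIdeal S) {N : Submodule R M} {b : ℤ}
    (h : IsGeneratedByLE (N.baseChange S) b) : IsGeneratedByLE N b := by
  set P : Submodule R N := maximalIdeal R • ⊤
  have htop : IsGeneratedByLE (⊤ : Submodule S (S ⊗[R] (N ⧸ P))) b :=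
    (h.top.top_of_surjective (f := (Submodule.toBaseChange.toLinearEquiv S N).symm.toLinearMap)
      (LinearEquiv.surjective _)).top_of_surjective
        (baseChange_surjective (Submodule.mkQ_surjective P))
  have hb : 0 ≤ b := by obtain ⟨s, -, hs⟩ := h; omega
  obtain ⟨n, rfl⟩ := Int.eq_ofNat_of_zero_le hb
  have hP : (maximalIdeal R • ⊤ : Submodule R (N ⧸ P)) = ⊥ := by
    rw [← LinearMap.range_eq_top.mpr (Submodule.mkQ_surjective P), ← Submodule.map_top,
      ← Submodule.map_smul'', Submodule.mkQ_map_self]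
  have hlen := length_le_of_isGeneratedByLE htop
    (by rw [← hS, map_smul_top_eq_baseChange, hP, Submodule.baseChange_bot])
  rw [length_baseChange_of_map_eq hS] at hlen
  obtain ⟨l, hl⟩ : ∃ l : ℕ, Module.length R (N ⧸ P) = l :=
    ⟨_, (ENat.natCast_toNat (ne_top_of_le_ne_top (ENat.natCast_ne_top n) hlen)).symm⟩
  have hln : l ≤ n := by rw [hl] at hlen; exact_mod_cast hlen
  have hgen : IsGeneratedByLE ((⊤ : Submodule R N).map P.mkQ) n := by
    rw [Submodule.map_top, Submodule.range_mkQ]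
    exact (isGeneratedByLE_top_of_length_eq hl).mono (by exact_mod_cast hln)
  have hNtop := hgen.of_map P.mkQ isGeneratedByLE_bot bot_le
    (by rw [Submodule.ker_mkQ, bot_sup_eq]; exact inf_le_right)
  have := hNtop.map N.subtype
  rwa [Submodule.map_top, Submodule.range_subtype, add_zero] at this

end BaseChange

section Extension

open Polynomial

universe u

lemma exists_flat_extension_infinite_residueField (R : Type u) [CommRing R] [IsNoetherianRing R]
    [IsLocalRing R] :
    ∃ (S : Type u) (_ : CommRing S) (_ : Algebra R S) (_ : IsLocalRing S),
      IsNoetherianRing S ∧ Module.Flat R S ∧ IsLocalHom (algebraMap R S) ∧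
      (maximalIdeal R).map (algebraMap R S) = maximalIdeal S ∧ Infinite (ResidueField S) := by
  set P : Ideal R[X] := (maximalIdeal R).map C
  have hP : P.IsPrime := Ideal.isPrime_map_C_of_isPrime
  let S := Localization.AtPrime P
  have hS : (maximalIdeal R).map (algebraMap R S) = maximalIdeal S := by
    rw [IsScalarTower.algebraMap_eq R R[X] S, ← Ideal.map_map]
    exact Localization.AtPrime.map_eq_maximalIdeal
  refine ⟨S, inferInstance, inferInstance, inferInstance,
    IsLocalization.isNoetherianRing P.primeCompl S inferInstance, ?_, ?_, hS, ?_⟩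
  · have : Module.Flat R[X] S := IsLocalization.flat S P.primeCompl
    exact Module.Flat.trans R R[X] S
  · exact ((local_hom_TFAE (algebraMap R S)).out 0 2).mpr hS.le
  · refine Infinite.of_injective (fun n : ℕ => residue S (algebraMap R[X] S (X ^ n)))
      fun i j h => ?_
    by_contra hij
    have hmem : (X ^ i - X ^ j : R[X]) ∈ P := by
      rw [← sub_eq_zero, ← map_sub, ← map_sub, residue_eq_zero_iff] at h
      exact (IsLocalization.AtPrime.to_map_mem_maximal_iff S P _).mp h
    have hc := Ideal.mem_map_C_iff.mp hmem i
    simp only [coeff_sub, coeff_X_pow, if_true, if_neg hij, sub_zero] at hc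
    exact (Ideal.ne_top_iff_one _).mp (maximalIdeal.isMaximal R).ne_top hc

end Extension

section Descent

universe u

/-- The infinite residue field hypothesis is removed by a flat base change. -/
lemma isGeneratedByLE_ker {R A Q : Type u} [CommRing R] [IsNoetherianRing R] [IsLocalRing R]
    [AddCommGroup A] [Module R A] [Module.Finite R A] [AddCommGroup Q] [Module R Q]
    [Module.Finite R Q] {π : A →ₗ[R] Q} (hπ : Function.Surjective π) {d q : ℕ}
    (hA : HasRegularSeqOfLength R A d) (hQ : HasRegularSeqOfLength R Q q) (hqd : q < d)
    {e e' : ℕ → ℤ} (he : HasModuleHilbertCoeffs R A d e) (he' : HasModuleHilbertCoeffs R Q q e') :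
    IsGeneratedByLE (LinearMap.ker π) (e 0 + ((d : ℤ) - q - 1) * e' 0) := by
  obtain ⟨S, _, _, _, _, _, _, hS, _⟩ := exists_flat_extension_infinite_residueField R
  refine IsGeneratedByLE.of_baseChange hS ?_
  rw [← ker_baseChange_eq_baseChange_ker hπ]
  exact isGeneratedByLE_ker_of_infinite_residueField (baseChange_surjective hπ) hA.baseChange
    hQ.baseChange hqd (he.baseChange hS) (he'.baseChange hS)

variable {R : Type u} [CommRing R] [IsLocalRing R]

lemma HasRegularSeqOfLength.of_quotient [IsNoetherianRing R] {I : Ideal R} {rs : List (R ⧸ I)}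
    (hm : ∀ x ∈ rs, x ∈ (maximalIdeal R).map (Ideal.Quotient.mk I))
    (h : RingTheory.Sequence.IsRegular (R ⧸ I) rs) :
    HasRegularSeqOfLength R (R ⧸ I) rs.length := by
  have hlift : ∀ x ∈ rs, ∃ r ∈ maximalIdeal R, Ideal.Quotient.mk I r = x := fun x hx =>
    (Ideal.mem_map_iff_of_surjective _ Ideal.Quotient.mk_surjective).mp (hm x hx)
  choose! f hf hfx using hlift
  have hmap : (rs.map f).map (algebraMap R (R ⧸ I)) = rs := by
    rw [List.map_map]
    exact (List.map_congr_left hfx).trans rs.map_id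
  have hmem : ∀ r ∈ rs.map f, r ∈ maximalIdeal R := by
    intro r hr
    obtain ⟨x, hx, rfl⟩ := List.mem_map.mp hr
    exact hf x hx
  have : Nontrivial (R ⧸ I) := h.nontrivial
  refine ⟨rs.map f, by simp, hmem, .of_isWeaklyRegular_of_mem_maximalIdeal _ hmem ?_⟩
  rw [← RingTheory.Sequence.isWeaklyRegular_map_algebraMap_iff (R ⧸ I), hmap]
  exact h.toIsWeaklyRegular

lemma HasHilbertCoeffs.hasModuleHilbertCoeffs {d : ℕ} {e : ℕ → ℤ}
    (h : HasHilbertCoeffs (maximalIdeal R) d e) : HasModuleHilbertCoeffs R R d e := by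
  obtain ⟨N, hN⟩ := h
  refine ⟨N, fun n hn => ?_⟩
  obtain ⟨l, hl, hle⟩ := hN n hn
  refine ⟨l, ?_, hle⟩
  rw [moduleLength, ← Module.coe_length] at hl
  rw [smul_eq_mul, Ideal.mul_top]
  exact_mod_cast hl

lemma HasHilbertCoeffs.hasModuleHilbertCoeffs_quotient {I : Ideal R} {d : ℕ} {e : ℕ → ℤ}
    (h : HasHilbertCoeffs ((maximalIdeal R).map (Ideal.Quotient.mk I)) d e) :
    HasModuleHilbertCoeffs R (R ⧸ I) d e := by
  obtain ⟨N, hN⟩ := h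
  refine ⟨N, fun n hn => ?_⟩
  obtain ⟨l, hl, hle⟩ := hN n hn
  refine ⟨l, ?_, hle⟩
  rw [moduleLength, ← Module.coe_length] at hl
  have heq : (maximalIdeal R ^ (n + 1) • ⊤ : Submodule R (R ⧸ I)) =
      ((maximalIdeal R).map (Ideal.Quotient.mk I) ^ (n + 1)).restrictScalars R := by
    rw [← Ideal.map_pow]
    exact Ideal.smul_top_eq_map _
  have hl : Module.length (R ⧸ I)
      ((R ⧸ I) ⧸ (maximalIdeal R).map (Ideal.Quotient.mk I) ^ (n + 1)) = l := by exact_mod_cast hl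
  rw [← hl, heq, ← Module.length_eq_of_surjective (S := R) (R := R ⧸ I)
    Ideal.Quotient.mk_surjective]
  exact LinearEquiv.length_eq (Submodule.Quotient.restrictScalarsEquiv R _)

end Descent

/-- **Vasconcelos (2003), Proposition 2.1**.  Let `(R,m)` be a Cohen-Macaulay Noetherian
local ring and `I` a Cohen-Macaulay ideal of height `g > 0` (i.e. `R/I` is Cohen-Macaulay).
Then `ν(I) ≤ e₀(R) + (g-1)·e₀(R/I)`. -/
theorem generators_le_multiplicity_bound
    {R : Type*} [CommRing R] [IsNoetherianRing R] [IsLocalRing R]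
    (hCM : IsCohenMacaulayLocalRing R)
    (I : Ideal R) (g : ℕ) (hg : 0 < g) (hht : idealHeight I = (g : ℕ∞))
    (hQCM : ∃ rs : List (R ⧸ I),
      (∀ x ∈ rs, x ∈ (maximalIdeal R).map (Ideal.Quotient.mk I)) ∧
      RingTheory.Sequence.IsRegular (R ⧸ I) rs ∧
      (rs.length : WithBot ℕ∞) = ringKrullDim (R ⧸ I))
    (dR : ℕ) (hdR : ringKrullDim R = dR)
    (eR : ℕ → ℤ) (heR : HasHilbertCoeffs (maximalIdeal R) dR eR)
    (dQ : ℕ) (hdQ : ringKrullDim (R ⧸ I) = dQ)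
    (eQ : ℕ → ℤ)
    (heQ : HasHilbertCoeffs ((maximalIdeal R).map (Ideal.Quotient.mk I)) dQ eQ) :
    ∃ s : Finset R, Ideal.span (s : Set R) = I ∧
      (s.card : ℤ) ≤ eR 0 + ((g : ℤ) - 1) * eQ 0 := by
  obtain ⟨rs, hm, hreg, hlen⟩ := hCM
  obtain ⟨rs', hm', hreg', hlen'⟩ := hQCM
  rw [hdR] at hlen
  rw [hdQ] at hlen'
  have hR : HasRegularSeqOfLength R R dR := ⟨rs, by exact_mod_cast hlen, hm, hreg⟩
  have hQ := HasRegularSeqOfLength.of_quotient hm' hreg'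
  rw [show rs'.length = dQ by exact_mod_cast hlen'] at hQ
  have hdim := hR.idealHeight_add_ringKrullDim_quotient hdR hdQ hht
  have h := isGeneratedByLE_ker (Submodule.mkQ_surjective I) hR hQ (by omega)
    heR.hasModuleHilbertCoeffs heQ.hasModuleHilbertCoeffs_quotient
  rw [Submodule.ker_mkQ, show (dR : ℤ) - dQ = g by omega] at h
  exact h
end

section
/- Let (R,m) be a Cohen-Macaulay Noetherian local ring of dimension d > 0 and let I be an m-primary ideal. Then ν(I) ≤ e_0(I) + d − 1, where ν(I) is the minimal number of generators of I. -/
open Finset IsLocalRing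

theorem IsLocalRing.spanFinrank_add_length_quotient {R : Type*} [CommRing R] [IsNoetherianRing R]
    [IsLocalRing R] (I : Ideal R) :
    (I.spanFinrank : ℕ∞) + Module.length R (R ⧸ I) =
      Module.length R (R ⧸ maximalIdeal R * I) := by
  have hlen : (I.spanFinrank : ℕ∞) =
      Module.length R (I ⧸ (maximalIdeal R • ⊤ : Submodule R I)) := by
    rw [spanFinrank_eq_finrank_quotient I I.fg_of_isNoetherianRing]
    let _ := Ideal.Quotient.field (maximalIdeal R)
    rw [Module.length_eq_of_surjective (R := R ⧸ maximalIdeal R) Ideal.Quotient.mk_surjective]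
    exact (Module.length_eq_finrank (R ⧸ maximalIdeal R) _).symm
  have hmap : (maximalIdeal R • ⊤ : Submodule R I).map I.subtype = maximalIdeal R * I := by
    rw [Submodule.map_smul'', Submodule.map_top, Submodule.range_subtype, smul_eq_mul]
  have hcomap : (maximalIdeal R • ⊤ : Submodule R I) =
      Submodule.comap I.subtype (maximalIdeal R * I) := by
    rw [← hmap, Submodule.comap_map_eq_of_injective I.subtype_injective]
  have hle : maximalIdeal R * I ≤ I := Ideal.mul_le_right
  rw [hlen]
  symm
  refine Module.length_eq_add_of_exact
    (Submodule.mapQ _ _ I.subtype hcomap.le) (Submodule.factor hle) ?_ ?_ ?_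
  · rw [← LinearMap.ker_eq_bot, Submodule.ker_mapQ, ← hcomap, Submodule.mkQ_map_self]
  · exact Submodule.factor_surjective hle
  · rw [LinearMap.exact_iff, Submodule.range_mapQ, Submodule.range_subtype, Submodule.ker_mapQ]
    simp

theorem IsLocalRing.length_quotient_map {R S : Type*} [CommRing R] [CommRing S] [IsLocalRing R]
    [IsLocalRing S] [Algebra R S] [Module.Flat R S]
    (hS : (maximalIdeal R).map (algebraMap R S) = maximalIdeal S) (I : Ideal R) :
    Module.length S (S ⧸ I.map (algebraMap R S)) = Module.length R (R ⧸ I) := by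
  have : IsLocalHom (algebraMap R S) :=
    ((IsLocalRing.local_hom_TFAE (algebraMap R S)).out 0 2).mpr hS.le
  rw [(Algebra.TensorProduct.quotIdealMapEquivTensorQuot S I).toLinearEquiv.length_eq,
    length_baseChange, hS]
  have : IsSimpleModule S (S ⧸ maximalIdeal S) :=
    isSimpleModule_iff_isCoatom.mpr (Ideal.isMaximal_def.mp inferInstance)
  rw [Module.length_eq_one S (S ⧸ maximalIdeal S), mul_one]

theorem IsLocalRing.spanFinrank_map {R S : Type*} [CommRing R] [CommRing S] [IsNoetherianRing R]
    [IsNoetherianRing S] [IsLocalRing R] [IsLocalRing S] [Algebra R S] [Module.Flat R S]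
    (hS : (maximalIdeal R).map (algebraMap R S) = maximalIdeal S) (I : Ideal R)
    (hI : Module.length R (R ⧸ I) ≠ ⊤) :
    (I.map (algebraMap R S)).spanFinrank = I.spanFinrank := by
  have h := spanFinrank_add_length_quotient (I.map (algebraMap R S))
  rw [← hS, ← Ideal.map_mul, length_quotient_map hS, length_quotient_map hS,
    ← spanFinrank_add_length_quotient] at h
  exact_mod_cast ENat.add_left_injective_of_ne_top hI h

theorem IsLocalRing.exists_mem_forall_notMem {R : Type*} [CommRing R] [IsLocalRing R]
    [Infinite (ResidueField R)] {I : Ideal R} (hI : I.FG) (s : Finset (Ideal R))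
    (hs : ∀ P ∈ s, ¬ I ≤ P) : ∃ x ∈ I, ∀ P ∈ s, x ∉ P := by
  by_contra! h
  have hcover : ⋃ P ∈ s, ((Submodule.comap I.subtype P : Submodule R I) : Set I) = Set.univ := by
    refine Set.eq_univ_of_forall fun x => ?_
    obtain ⟨P, hP, hx⟩ := h x x.2
    exact Set.mem_biUnion hP hx
  obtain ⟨P, hP, hfin⟩ := Submodule.exists_finiteIndex_of_cover hcover
  have : Module.Finite R I := Module.Finite.iff_fg.mpr hI
  obtain ⟨Q, hQ, hPQ⟩ := (eq_top_or_exists_le_coatom (Submodule.comap I.subtype P)).resolve_left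
    fun htop => hs P hP fun x hx => by
      have : (⟨x, hx⟩ : I) ∈ Submodule.comap I.subtype P := htop ▸ Submodule.mem_top
      exact this
  have hQfin : Q.toAddSubgroup.FiniteIndex :=
    AddSubgroup.finiteIndex_of_le (H := (Submodule.comap I.subtype P).toAddSubgroup) hPQ
  have : Finite (I ⧸ Q) := AddSubgroup.finite_quotient_of_finiteIndex (H := Q.toAddSubgroup)
  obtain ⟨m, hm, ⟨e⟩⟩ := isSimpleModule_iff_quot_maximal.mp (isSimpleModule_iff_isCoatom.mpr hQ)
  obtain rfl := eq_maximalIdeal hm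
  have : Finite (ResidueField R) := Finite.of_equiv _ e.toEquiv
  exact not_finite (ResidueField R)

namespace Ideal
variable {R : Type*} [CommRing R] (I : Ideal R)

/-- The ideal of the Rees algebra whose quotient is the associated graded ring of `I`. -/
def reesGradedKernel : Ideal (reesAlgebra I) where
  carrier := {f | ∀ n, (f : Polynomial R).coeff n ∈ I ^ (n + 1)}
  zero_mem' n := by simp
  add_mem' hf hg n := by simpa using add_mem (hf n) (hg n)
  smul_mem' f g hg n := by
    simp only [smul_eq_mul, MulMemClass.coe_mul, Polynomial.coeff_mul]
    refine _root_.sum_mem fun p hp => ?_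
    rw [← mem_antidiagonal.mp hp, add_assoc, pow_add]
    exact mul_mem_mul ((mem_reesAlgebra_iff I f).mp f.2 p.1) (hg p.2)

/-- The embedding of `I` into the Rees algebra of `I` as its component of degree one. -/
noncomputable def toReesAlgebra : I →ₗ[R] reesAlgebra I where
  toFun x := ⟨Polynomial.monomial 1 (x : R), reesAlgebra.monomial_mem.mpr (by simp)⟩
  map_add' x y := by ext1; simp
  map_smul' r x := by ext1; simp [Polynomial.smul_monomial]

variable {I} in
theorem exists_mem_span_range_toReesAlgebra_pow (n : ℕ) {g : R} (hg : g ∈ I ^ n) :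
    ∃ a ∈ span (Set.range I.toReesAlgebra) ^ n, (a : Polynomial R) = Polynomial.monomial n g := by
  induction n generalizing g with
  | zero => exact ⟨algebraMap R _ g, by simp, by simp [Polynomial.monomial_zero_left]⟩
  | succ n ih =>
    rw [pow_succ] at hg
    induction hg using Submodule.mul_induction_on' with
    | mem_mul_mem u hu v hv =>
      obtain ⟨a, ha, hau⟩ := ih hu
      refine ⟨a * I.toReesAlgebra ⟨v, hv⟩, ?_, ?_⟩
      · rw [pow_succ]
        exact mul_mem_mul ha (subset_span ⟨_, rfl⟩)
      · simp [hau, toReesAlgebra, Polynomial.monomial_mul_monomial]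
    | add u _ v _ hu hv =>
      obtain ⟨a, ha, hau⟩ := hu
      obtain ⟨b, hb, hbv⟩ := hv
      exact ⟨a + b, add_mem ha hb, by simp [hau, hbv]⟩

/-- Elements of `I` outside finitely many ideals not containing `I` are superficial. -/
theorem exists_finset_superficial [IsNoetherianRing R] :
    ∃ s : Finset (Ideal R), (∀ P ∈ s, ¬ I ≤ P) ∧ ∃ N : ℕ, ∀ x ∈ I, (∀ P ∈ s, x ∉ P) →
      ∀ n ≥ N, ∀ g ∈ I ^ n, x * g ∈ I ^ (n + 2) → g ∈ I ^ (n + 1) := by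
  classical
  obtain ⟨t, ht, htp⟩ := Submodule.isLasker (reesAlgebra I) (reesAlgebra I) I.reesGradedKernel
  let P (q : Ideal (reesAlgebra I)) : Ideal R :=
    Submodule.map I.subtype (Submodule.comap I.toReesAlgebra (q.radical.restrictScalars R))
  have mem_P (q : Ideal (reesAlgebra I)) (x : R) (hx : x ∈ I) :
      x ∈ P q ↔ I.toReesAlgebra ⟨x, hx⟩ ∈ q.radical := by
    constructor
    · rintro ⟨y, hy, rfl⟩
      exact hy
    · exact fun h => ⟨⟨x, hx⟩, h, rfl⟩
  have pow_le (q : Ideal (reesAlgebra I)) (hq : I ≤ P q) :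
      ∃ N, span (Set.range I.toReesAlgebra) ^ N ≤ q := by
    refine exists_pow_le_of_le_radical_of_fg (span_le.mpr ?_) (IsNoetherian.noetherian _)
    rintro _ ⟨⟨x, hx⟩, rfl⟩
    exact (mem_P q x hx).mp (hq hx)
  choose! N hN using pow_le
  refine ⟨(t.filter fun q => ¬ I ≤ P q).image P, ?_, t.sup N, ?_⟩
  · intro Q hQ
    obtain ⟨q, hq, rfl⟩ := mem_image.mp hQ
    exact (mem_filter.mp hq).2
  · intro x hx hxs n hn g hg hxg
    obtain ⟨a, ha, hag⟩ := exists_mem_span_range_toReesAlgebra_pow n hg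
    have hprod : a * I.toReesAlgebra ⟨x, hx⟩ ∈ I.reesGradedKernel := by
      intro k
      simp only [MulMemClass.coe_mul, hag, toReesAlgebra, LinearMap.coe_mk, AddHom.coe_mk,
        Polynomial.monomial_mul_monomial, Polynomial.coeff_monomial]
      split_ifs with hk
      · subst hk
        rwa [mul_comm g]
      · exact zero_mem _
    have hker : a ∈ I.reesGradedKernel := by
      rw [← ht, Submodule.mem_finsetInf] at hprod ⊢
      intro q hq
      by_cases hIq : I ≤ P q
      · exact hN q hIq (pow_le_pow_right ((le_sup hq).trans hn) ha)
      · refine ((isPrimary_iff.mp (htp hq)).2 (hprod q hq)).resolve_right fun h => ?_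
        exact hxs (P q) (mem_image_of_mem P (mem_filter.mpr ⟨hq, hIq⟩)) ((mem_P q x hx).mpr h)
    have := hker n
    rwa [hag, Polynomial.coeff_monomial_same] at this

theorem eventually_mem_pow_of_mul_mem [IsNoetherianRing R] {I : Ideal R} {x : R}
    (hx : IsSMulRegular R x) {N : ℕ}
    (hsup : ∀ n ≥ N, ∀ g ∈ I ^ n, x * g ∈ I ^ (n + 2) → g ∈ I ^ (n + 1)) :
    ∃ N' : ℕ, ∀ n ≥ N', ∀ g, x * g ∈ I ^ (n + 1) → g ∈ I ^ n := by
  obtain ⟨k, hk⟩ := exists_pow_inf_eq_pow_smul I (span {x})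
  refine ⟨N + k, fun n hn g hg => ?_⟩
  have hgN : g ∈ I ^ N := by
    have hmem : x * g ∈ I ^ (n + 1) • (⊤ : Ideal R) ⊓ span {x} :=
      ⟨by simpa using hg, mem_span_singleton.mpr ⟨g, rfl⟩⟩
    rw [hk (n + 1) (by omega)] at hmem
    have hle : I ^ (n + 1 - k) • (I ^ k • (⊤ : Ideal R) ⊓ span {x}) ≤ I ^ N * span {x} :=
      Submodule.smul_mono (pow_le_pow_right (by omega)) inf_le_right
    obtain ⟨z, hz, hzx⟩ := mem_mul_span_singleton.mp (hle hmem)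
    have : g = z := hx (by simp only [smul_eq_mul, ← hzx, mul_comm])
    exact this ▸ hz
  have step (m : ℕ) (hm : N + m ≤ n) : g ∈ I ^ (N + m) := by
    induction m with
    | zero => exact hgN
    | succ m ih =>
      exact hsup (N + m) (by omega) g (ih (by omega)) (pow_le_pow_right (by omega) hg)
  have := step (n - N) (by omega)
  rwa [Nat.add_sub_cancel' (by omega)] at this

end Ideal

theorem Ideal.length_quotient_pow_succ {R : Type*} [CommRing R] {I : Ideal R} {x : R} (hxI : x ∈ I)
    (n : ℕ) (h : ∀ g, x * g ∈ I ^ (n + 1) → g ∈ I ^ n) :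
    Module.length R (R ⧸ I ^ (n + 1)) = Module.length R (R ⧸ I ^ n) +
      Module.length (R ⧸ span {x})
        ((R ⧸ span {x}) ⧸ (I.map (Quotient.mk (span {x}))) ^ (n + 1)) := by
  have hmul (g : R) : g ∈ I ^ n ↔ x * g ∈ I ^ (n + 1) :=
    ⟨fun hg => pow_succ' I n ▸ mul_mem_mul hxI hg, h g⟩
  rw [← Ideal.map_pow, ← Module.length_eq_of_surjective (S := R) Quotient.mk_surjective]
  let f : (R ⧸ I ^ n) →ₗ[R] (R ⧸ I ^ (n + 1)) :=
    Submodule.mapQ _ _ (LinearMap.mulLeft R x) fun g hg => (hmul g).mp hg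
  let g : (R ⧸ I ^ (n + 1)) →ₗ[R]
      ((R ⧸ span {x}) ⧸ (I ^ (n + 1)).map (Quotient.mk (span {x}))) :=
    (quotientMapₐ _ (Quotient.mkₐ R (span {x})) le_comap_map).toLinearMap
  refine Module.length_eq_add_of_exact f g ?_ ?_ ?_
  · rw [← LinearMap.ker_eq_bot, LinearMap.ker_eq_bot']
    intro a ha
    obtain ⟨a, rfl⟩ := Quotient.mk_surjective a
    exact Quotient.eq_zero_iff_mem.mpr ((hmul a).mpr (Quotient.eq_zero_iff_mem.mp ha))
  · intro a
    obtain ⟨a, rfl⟩ := Quotient.mk_surjective a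
    obtain ⟨a, rfl⟩ := Quotient.mk_surjective a
    exact ⟨Quotient.mk _ a, rfl⟩
  · intro a
    obtain ⟨a, rfl⟩ := Quotient.mk_surjective a
    have : g (Quotient.mk _ a) = 0 ↔ a ∈ I ^ (n + 1) ⊔ span {x} := by
      have : g (Quotient.mk _ a) = Quotient.mk _ (Quotient.mk (span {x}) a) := rfl
      rw [this, Quotient.eq_zero_iff_mem, mem_quotient_iff_mem_sup]
    rw [this]
    constructor
    · intro ha
      obtain ⟨b, hb, c, hc, rfl⟩ := Submodule.mem_sup.mp ha
      obtain ⟨r, rfl⟩ := mem_span_singleton.mp hc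
      exact ⟨Quotient.mk _ r, show Quotient.mk (I ^ (n + 1)) (x * r) = Quotient.mk _ (b + x * r) from
        Quotient.eq.mpr (by simpa using hb)⟩
    · rintro ⟨r, hr⟩
      obtain ⟨r, rfl⟩ := Quotient.mk_surjective r
      have := Quotient.eq.mp (show Quotient.mk (I ^ (n + 1)) (x * r) = Quotient.mk _ a from hr)
      rw [← sub_sub_cancel (x * r) a]
      exact sub_mem (Submodule.mem_sup_right (mem_span_singleton.mpr ⟨r, rfl⟩))
        (Submodule.mem_sup_left this)

theorem Ideal.spanFinrank_le_spanFinrank_map_quotient_add_one {R : Type*} [CommRing R]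
    [IsNoetherianRing R] {I : Ideal R} {x : R} (hxI : x ∈ I) :
    I.spanFinrank ≤ (I.map (Quotient.mk (span {x}))).spanFinrank + 1 := by
  classical
  obtain ⟨t, ht, hspan⟩ := (IsNoetherian.noetherian
    (I.map (Quotient.mk (span {x})))).exists_span_finset_card_eq_spanFinrank
  have hlift (y : R ⧸ span {x}) (hy : y ∈ I.map (Quotient.mk (span {x}))) :
      ∃ z ∈ I, Quotient.mk (span {x}) z = y :=
    (mem_map_iff_of_surjective _ Quotient.mk_surjective).mp hy
  choose! z hzI hz using hlift
  have hI : Submodule.span R (insert x (t.image z) : Finset R) = I := by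
    apply le_antisymm
    · rw [Submodule.span_le]
      intro y hy
      rcases mem_insert.mp hy with rfl | hy
      · exact hxI
      · obtain ⟨w, hw, rfl⟩ := mem_image.mp hy
        exact hzI w (hspan ▸ Submodule.subset_span (mem_coe.mpr hw))
    · have hmap : I.map (Quotient.mk (span {x})) ≤
          (span (t.image z : Set R)).map (Quotient.mk (span {x})) := by
        rw [← hspan, Submodule.span_le]
        intro y hy
        have := mem_map_of_mem (Quotient.mk (span {x}))
          (subset_span (mem_coe.mpr (mem_image_of_mem z hy)) : z y ∈ span (t.image z : Set R))
        rwa [hz y (hspan ▸ Submodule.subset_span hy)] at this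
      have := map_le_iff_le_comap.mp hmap
      rw [comap_map_of_surjective' _ Quotient.mk_surjective, mk_ker] at this
      refine this.trans ?_
      rw [← span_union, coe_insert, Set.insert_eq, Set.union_comm]
  calc I.spanFinrank ≤ Set.ncard ((insert x (t.image z) : Finset R) : Set R) := by
        conv_lhs => rw [← hI]
        exact Submodule.spanFinrank_span_le_ncard_of_finite (finite_toSet _)
    _ ≤ _ := by
        rw [Set.ncard_coe_finset]
        exact (card_insert_le _ _).trans (Nat.succ_le_succ (card_image_le.trans ht.le))

open RingTheory.Sequence in
theorem IsLocalRing.isWeaklyRegular_cons_of_concat {R : Type*} [CommRing R] [IsNoetherianRing R]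
    [IsLocalRing R] {as : List R} {x : R} (has : ∀ a ∈ as, a ∈ maximalIdeal R)
    (hx : x ∈ maximalIdeal R) (h : IsWeaklyRegular R (as ++ [x])) :
    IsSMulRegular R x ∧ IsWeaklyRegular (R ⧸ Ideal.span {x})
      (as.map (Ideal.Quotient.mk (Ideal.span {x}))) := by
  have h' := isWeaklyRegular_of_perm_of_subset_maximalIdeal h (List.perm_append_singleton x as)
    (by simpa [or_imp, forall_and] using ⟨has, hx⟩)
  rw [isWeaklyRegular_cons_iff] at h'
  refine ⟨h'.1, ?_⟩
  have e : QuotSMulTop x R ≃ₗ[R] R ⧸ Ideal.span {x} :=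
    Submodule.quotEquivOfEq _ _
      (by rw [← Submodule.ideal_span_singleton_smul, smul_eq_mul, Ideal.mul_top])
  exact (isWeaklyRegular_map_algebraMap_iff (S := R ⧸ Ideal.span {x}) (R ⧸ Ideal.span {x}) as).mpr
    ((e.isWeaklyRegular_congr as).mp h'.2)

open RingTheory.Sequence in
theorem RingTheory.Sequence.exists_finset_isWeaklyRegular_concat {R : Type*} [CommRing R]
    [IsNoetherianRing R] {as : List R} {b : R} {I : Ideal R} (hb : b ∈ I.radical)
    (h : IsWeaklyRegular R (as ++ [b])) :
    ∃ s : Finset (Ideal R), (∀ P ∈ s, ¬ I ≤ P) ∧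
      ∀ x, (∀ P ∈ s, x ∉ P) → IsWeaklyRegular R (as ++ [x]) := by
  have hfin := associatedPrimes.finite R (R ⧸ (Ideal.ofList as • ⊤ : Submodule R R))
  have key (x : R) : IsSMulRegular (R ⧸ (Ideal.ofList as • ⊤ : Submodule R R)) x ↔
      ∀ P ∈ associatedPrimes R (R ⧸ (Ideal.ofList as • ⊤ : Submodule R R)), x ∉ P := by
    have := Set.ext_iff.mp (biUnion_associatedPrimes_eq_compl_regular R
      (R ⧸ (Ideal.ofList as • ⊤ : Submodule R R))) x
    simp only [Set.mem_iUnion, Set.mem_compl_iff, SetLike.mem_coe] at this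
    rw [← not_iff_not, not_forall]
    simpa using this.symm
  rw [isWeaklyRegular_append_iff, isWeaklyRegular_singleton_iff, key] at h
  refine ⟨hfin.toFinset, fun P hP hIP => ?_, fun x hx => ?_⟩
  · rw [Set.Finite.mem_toFinset] at hP
    exact h.2 P hP ((Ideal.IsPrime.radical_le_iff hP.isPrime).mpr hIP hb)
  · rw [isWeaklyRegular_append_iff, isWeaklyRegular_singleton_iff, key]
    exact ⟨h.1, fun P hP => hx P (hfin.mem_toFinset.mpr hP)⟩

/-- The length of `R ⧸ I ^ n`, as an integer-valued function of `n`. -/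
noncomputable def Ideal.hilbertSamuel {R : Type*} [CommRing R] (I : Ideal R) (n : ℕ) : ℤ :=
  (Module.length R (R ⧸ I ^ n)).toNat

theorem Ideal.length_quotient_pow_ne_top {R : Type*} [CommRing R] {I : Ideal R} {N : ℕ}
    (h : ∀ n ≥ N, Module.length R (R ⧸ I ^ n) ≠ ⊤) (n : ℕ) : Module.length R (R ⧸ I ^ n) ≠ ⊤ :=
  ne_top_of_le_ne_top (h (max n N) (le_max_right _ _))
    (Module.length_le_of_surjective _
      (Submodule.factor_surjective (pow_le_pow_right (le_max_left n N))))

theorem fwdDiff_iter_congr {f g : ℕ → ℤ} {N : ℕ} (h : ∀ n ≥ N, f n = g n) (d n : ℕ) (hn : N ≤ n) :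
    (fwdDiff 1)^[d] f n = (fwdDiff 1)^[d] g n := by
  induction d generalizing f g with
  | zero => exact h n hn
  | succ d ih =>
    simp only [Function.iterate_succ_apply]
    exact ih fun m hm => by simp only [fwdDiff, h m hm, h (m + 1) (by omega)]

/-- An ideal of an Artinian local ring is generated by fewer elements than the length of the
ring. -/
theorem Ideal.spanFinrank_le_of_hilbertSamuel_eventually_const {R : Type*} [CommRing R]
    [IsNoetherianRing R] [IsLocalRing R] {I : Ideal R} (hI : I ≤ maximalIdeal R)
    (hfin : ∀ n, Module.length R (R ⧸ I ^ n) ≠ ⊤) {e : ℤ} {N : ℕ}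
    (he : ∀ n ≥ N, I.hilbertSamuel n = e) : (I.spanFinrank : ℤ) ≤ e - 1 := by
  have hlen : Module.length R (R ⧸ I ^ (N + 1)) = Module.length R (R ⧸ I ^ N) := by
    rw [← ENat.natCast_toNat (hfin N), ← ENat.natCast_toNat (hfin (N + 1))]
    have := (he (N + 1) (by omega)).trans (he N le_rfl).symm
    simp only [hilbertSamuel] at this
    exact_mod_cast this
  have hle : I ^ (N + 1) ≤ I ^ N := pow_le_pow_right N.le_succ
  have hpow : I ^ N ≤ I ^ (N + 1) := by
    have hex := Module.length_eq_add_of_exact (LinearMap.ker (Submodule.factor hle)).subtype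
      (Submodule.factor hle) (Submodule.subtype_injective _) (Submodule.factor_surjective hle)
      (LinearMap.exact_subtype_ker_map _)
    rw [hlen] at hex
    have h0 : Module.length R (LinearMap.ker (Submodule.factor hle)) = 0 :=
      ENat.add_left_injective_of_ne_top (hfin N) (by simpa using hex.symm)
    rw [Module.length_eq_zero_iff, Submodule.subsingleton_iff_eq_bot] at h0
    intro a ha
    have : Submodule.Quotient.mk a ∈ LinearMap.ker (Submodule.factor hle) := by
      simpa [Submodule.factor_mk] using (Submodule.Quotient.mk_eq_zero _).mpr ha
    rw [h0, Submodule.mem_bot] at this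
    exact (Submodule.Quotient.mk_eq_zero _).mp this
  have hbot : I ^ N = ⊥ := by
    refine Submodule.eq_bot_of_le_smul_of_le_jacobson_bot I _ (IsNoetherian.noetherian _) ?_
      (hI.trans (maximalIdeal_le_jacobson _))
    rwa [smul_eq_mul, ← pow_succ']
  have hlt : (I.spanFinrank : ℕ∞) + 1 ≤ Module.length R (R ⧸ I ^ N) := by
    have hnt : Nontrivial (R ⧸ I) := Quotient.nontrivial_iff.mpr
      (ne_top_of_le_ne_top (Ideal.IsPrime.ne_top inferInstance) hI)
    have hone : 1 ≤ Module.length R (R ⧸ I) := Order.one_le_iff_pos.mpr Module.length_pos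
    refine (add_le_add_right hone _).trans ?_
    rw [spanFinrank_add_length_quotient, hbot]
    exact Module.length_le_of_surjective _
      (Submodule.factor_surjective (bot_le : ⊥ ≤ maximalIdeal R * I))
  have := he N le_rfl
  rw [← ENat.natCast_toNat (hfin N)] at hlt
  have : I.spanFinrank + 1 ≤ (Module.length R (R ⧸ I ^ N)).toNat := by exact_mod_cast hlt
  simp only [hilbertSamuel] at *
  omega

open RingTheory.Sequence in
theorem Ideal.spanFinrank_le_of_infinite_residueField {R : Type*} [CommRing R] [IsNoetherianRing R]
    [IsLocalRing R] [Infinite (IsLocalRing.ResidueField R)] {I : Ideal R} (hI : I ≤ maximalIdeal R)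
    (hfin : ∀ n, Module.length R (R ⧸ I ^ n) ≠ ⊤) {rs : List R} (hrs : ∀ r ∈ rs, r ∈ I.radical)
    (hreg : IsWeaklyRegular R rs) {e : ℤ} {N : ℕ}
    (he : ∀ n ≥ N, (fwdDiff 1)^[rs.length] I.hilbertSamuel n = e) :
    (I.spanFinrank : ℤ) ≤ e + rs.length - 1 := by
  induction hd : rs.length generalizing R N with
  | zero =>
    rw [hd] at he
    simpa using spanFinrank_le_of_hilbertSamuel_eventually_const hI hfin he
  | succ d ih =>
    obtain ⟨as, b, rfl⟩ : ∃ as b, rs = as ++ [b] :=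
      ⟨_, _, (List.dropLast_append_getLast (List.ne_nil_of_length_eq_add_one hd)).symm⟩
    classical
    obtain ⟨s, hs, hsreg⟩ := exists_finset_isWeaklyRegular_concat (hrs b (by simp)) hreg
    obtain ⟨t, ht, M, htsup⟩ := I.exists_finset_superficial
    obtain ⟨x, hxI, hx⟩ := exists_mem_forall_notMem I.fg_of_isNoetherianRing (s ∪ t)
      fun P hP => (mem_union.mp hP).elim (hs P) (ht P)
    have hxm := hI hxI
    have hrad : I.radical ≤ maximalIdeal R :=
      (Ideal.IsPrime.radical_le_iff inferInstance).mpr hI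
    obtain ⟨hxreg, hasreg⟩ := isWeaklyRegular_cons_of_concat
      (fun a ha => hrad (hrs a (by simp [ha]))) hxm
      (hsreg x fun P hP => hx P (mem_union_left _ hP))
    obtain ⟨K, hK⟩ := eventually_mem_pow_of_mul_mem hxreg
      (htsup x hxI fun P hP => hx P (mem_union_right _ hP))
    have : Nontrivial (R ⧸ span {x}) := Quotient.nontrivial_iff.mpr
      (ne_top_of_le_ne_top (Ideal.IsPrime.ne_top inferInstance)
        ((span_singleton_le_iff_mem _).mpr hxm))
    have : IsLocalRing (R ⧸ span {x}) := .of_surjective' _ Quotient.mk_surjective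
    have : IsLocalHom (Quotient.mk (span {x})) := .of_surjective _ Quotient.mk_surjective
    have : Infinite (IsLocalRing.ResidueField (R ⧸ span {x})) :=
      .of_injective _ (IsLocalRing.ResidueField.map (Quotient.mk (span {x}))).injective
    have hmap : I.map (Quotient.mk (span {x})) ≤ maximalIdeal (R ⧸ span {x}) :=
      (map_mono hI).trans
        (((IsLocalRing.local_hom_TFAE (Quotient.mk (span {x}))).out 0 2 rfl rfl).mp ‹_›)
    have hlen (n : ℕ) (hn : K ≤ n) := length_quotient_pow_succ hxI n (hK n hn)
    have hfin' : ∀ n, Module.length (R ⧸ span {x})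
        ((R ⧸ span {x}) ⧸ (I.map (Quotient.mk (span {x}))) ^ n) ≠ ⊤ := by
      refine length_quotient_pow_ne_top (N := K + 1) fun n hn => ?_
      obtain ⟨n, rfl⟩ := Nat.exists_eq_add_of_le' (show 1 ≤ n by omega)
      exact ne_top_of_le_ne_top (hfin (n + 1)) (hlen n (by omega) ▸ le_add_self)
    have hdiff (n : ℕ) (hn : n ≥ K) :
        (I.map (Quotient.mk (span {x}))).hilbertSamuel (n + 1) =
          fwdDiff 1 I.hilbertSamuel n := by
      have := hlen n hn
      rw [← ENat.natCast_toNat (hfin _), ← ENat.natCast_toNat (hfin n),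
        ← ENat.natCast_toNat (hfin' _)] at this
      norm_cast at this
      simp only [fwdDiff, hilbertSamuel, this]
      push_cast
      ring
    have hlas : (as.map (Quotient.mk (span {x}))).length = d := by simpa using hd
    have := ih hmap hfin' (rs := as.map (Quotient.mk (span {x}))) (N := max N K + 1) ?_
      hasreg ?_ hlas
    · have := spanFinrank_le_spanFinrank_map_quotient_add_one hxI
      push_cast
      omega
    · intro r hr
      obtain ⟨a, ha, rfl⟩ := List.mem_map.mp hr
      obtain ⟨k, hk⟩ := hrs a (by simp [ha])
      exact ⟨k, by rw [← map_pow]; exact mem_map_of_mem _ hk⟩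
    · intro n hn
      obtain ⟨n, rfl⟩ := Nat.exists_eq_add_of_le' (show 1 ≤ n by omega)
      rw [hlas, ← fwdDiff_iter_comp_add, fwdDiff_iter_congr hdiff d n (by omega),
        ← Function.iterate_succ_apply, Nat.succ_eq_add_one, ← hd]
      exact he n (by omega)

/-- A local ring has a flat local extension with infinite residue field whose maximal ideal is
extended from the base, namely the localization of `R[X]` at the extended maximal ideal. -/
theorem IsLocalRing.exists_flat_infinite_residueField.{u} (R : Type u) [CommRing R]
    [IsNoetherianRing R] [IsLocalRing R] :
    ∃ (S : Type u) (_ : CommRing S) (_ : IsNoetherianRing S) (_ : IsLocalRing S)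
      (_ : Algebra R S), Module.Flat R S ∧ Infinite (ResidueField S) ∧
        (maximalIdeal R).map (algebraMap R S) = maximalIdeal S := by
  let P : Ideal (Polynomial R) := (maximalIdeal R).map Polynomial.C
  have hP : P.IsPrime := Ideal.isPrime_map_C_of_isPrime
  have hmem (f : Polynomial R) : algebraMap _ (Localization.AtPrime P) f ∈
      maximalIdeal (Localization.AtPrime P) ↔ f ∈ P :=
    IsLocalization.AtPrime.to_map_mem_maximal_iff _ P f
  refine ⟨Localization.AtPrime P, inferInstance, inferInstance, inferInstance, inferInstance,
    Module.Flat.trans R (Polynomial R) _, ?_, ?_⟩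
  · refine Infinite.of_injective
      (fun n : ℕ => residue (Localization.AtPrime P)
        (algebraMap (Polynomial R) _ (Polynomial.X ^ n)))
      fun m n hmn => ?_
    by_contra hne
    have hsub : (Polynomial.X ^ m - Polynomial.X ^ n : Polynomial R) ∈ P := by
      rw [← hmem, map_sub, ← residue_eq_zero_iff, map_sub, sub_eq_zero]
      exact hmn
    have := Ideal.mem_map_C_iff.mp hsub m
    simp [Polynomial.coeff_X_pow, hne] at this
  · rw [IsScalarTower.algebraMap_eq R (Polynomial R), ← Ideal.map_map]
    exact Localization.AtPrime.map_eq_maximalIdeal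

theorem fwdDiff_iter_choose_add_sub (d i : ℕ) (hi : i ≤ d) :
    (fwdDiff 1)^[d] (fun n : ℕ => ((n + d - i).choose (d - i) : ℤ)) =
      fun _ => if i = 0 then 1 else 0 := by
  obtain ⟨k, rfl⟩ := Nat.exists_eq_add_of_le hi
  funext n
  have h (n : ℕ) : n + (i + k) - i = n + k := by omega
  simp only [h, Nat.add_sub_cancel_left]
  rw [fwdDiff_iter_comp_add 1 (fun n : ℕ => (n.choose k : ℤ)) k (i + k) n,
    Function.iterate_add_apply]
  have := fwdDiff_iter_choose 0 k
  simp only [add_zero, Nat.choose_zero_right, Nat.cast_one] at this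
  rw [this]
  cases i with
  | zero => simp
  | succ i =>
    rw [Function.iterate_succ_apply, fwdDiff_const]
    simp [fwdDiff_iter_eq_sum_shift]

theorem HasHilbertCoeffs.fwdDiff_hilbertSamuel {R : Type*} [CommRing R] {I : Ideal R} {d : ℕ}
    {e : ℕ → ℤ} (h : HasHilbertCoeffs I d e) :
    ∃ N : ℕ, ∀ n ≥ N, Module.length R (R ⧸ I ^ n) ≠ ⊤ ∧
      (fwdDiff 1)^[d] I.hilbertSamuel n = e 0 := by
  obtain ⟨N, hN⟩ := h
  have hlen (n : ℕ) (hn : n ≥ N) : Module.length R (R ⧸ I ^ (n + 1)) ≠ ⊤ ∧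
      I.hilbertSamuel (n + 1) =
        ∑ i ∈ range (d + 1), (-1 : ℤ) ^ i * e i * ((n + d - i).choose (d - i)) := by
    obtain ⟨l, hl, hsum⟩ := hN n hn
    have hl' : Module.length R (R ⧸ I ^ (n + 1)) = l := by
      rw [moduleLength, ← Module.coe_length] at hl
      exact_mod_cast hl
    refine ⟨hl' ▸ ENat.natCast_ne_top l, ?_⟩
    rw [← hsum, Ideal.hilbertSamuel, hl', ENat.toNat_natCast]
  refine ⟨N + 1, fun n hn => ?_⟩
  obtain ⟨n, rfl⟩ := Nat.exists_eq_add_of_le' (show 1 ≤ n by omega)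
  refine ⟨(hlen n (by omega)).1, ?_⟩
  rw [← fwdDiff_iter_comp_add, fwdDiff_iter_congr (fun n hn => (hlen n hn).2) d n (by omega)]
  have hsum : (fun n : ℕ => ∑ i ∈ range (d + 1),
      (-1 : ℤ) ^ i * e i * ((n + d - i).choose (d - i))) =
      ∑ i ∈ range (d + 1), ((-1 : ℤ) ^ i * e i) • fun n : ℕ => ((n + d - i).choose (d - i) : ℤ) := by
    ext n
    simp
  rw [hsum, fwdDiff_iter_finsetSum, Finset.sum_apply, Finset.sum_eq_single 0]
  · rw [fwdDiff_iter_const_smul, fwdDiff_iter_choose_add_sub d 0 (Nat.zero_le d)]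
    simp
  · intro i hi hi0
    rw [fwdDiff_iter_const_smul,
      fwdDiff_iter_choose_add_sub d i (by simpa [Nat.lt_succ_iff] using hi)]
    simp [hi0]
  · simp

/-- **Vasconcelos (2003), Proposition 2.5**.  Let `(R,m)` be a Cohen-Macaulay Noetherian
local ring of dimension `d > 0` and `I` an `m`-primary ideal.  Then `ν(I) ≤ e₀(I) + d - 1`. -/
theorem generators_le_e0_add_dim_sub_one
    {R : Type*} [CommRing R] [IsNoetherianRing R] [IsLocalRing R]
    (d : ℕ) (hd : 0 < d) (hdim : ringKrullDim R = d)
    (hCM : IsCohenMacaulayLocalRing R)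
    (I : Ideal R) (hI : I.radical = maximalIdeal R)
    (e : ℕ → ℤ) (he : HasHilbertCoeffs I d e) :
    ∃ s : Finset R, Ideal.span (s : Set R) = I ∧ (s.card : ℤ) ≤ e 0 + d - 1 := by
  obtain ⟨rs, hrs, hreg, hlen⟩ := hCM
  obtain rfl : rs.length = d := by
    rw [hdim] at hlen
    exact_mod_cast hlen
  obtain ⟨N, hN⟩ := he.fwdDiff_hilbertSamuel
  have hfin := Ideal.length_quotient_pow_ne_top fun n hn => (hN n hn).1
  obtain ⟨S, _, _, _, _, _, _, hS⟩ := exists_flat_infinite_residueField R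
  have hlenS (n : ℕ) : Module.length S (S ⧸ (I.map (algebraMap R S)) ^ n) =
      Module.length R (R ⧸ I ^ n) := by
    rw [← Ideal.map_pow, length_quotient_map hS]
  have hbound := Ideal.spanFinrank_le_of_infinite_residueField (I := I.map (algebraMap R S))
    (rs := rs.map (algebraMap R S)) (e := e 0) (N := N)
    (hS ▸ Ideal.map_mono (hI ▸ Ideal.le_radical)) (fun n => hlenS n ▸ hfin n) ?_
    hreg.toIsWeaklyRegular.of_flat ?_
  · rw [spanFinrank_map hS I (by have := hfin 1; rwa [pow_one] at this), List.length_map] at hbound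
    obtain ⟨s, hs, hspan⟩ :=
      (IsNoetherian.noetherian I).exists_span_finset_card_eq_spanFinrank
    exact ⟨s, hspan, hs ▸ hbound⟩
  · intro r hr
    obtain ⟨a, ha, rfl⟩ := List.mem_map.mp hr
    obtain ⟨k, hk⟩ := hI ▸ hrs a ha
    exact ⟨k, by rw [← map_pow]; exact Ideal.mem_map_of_mem _ hk⟩
  · intro n hn
    have : (I.map (algebraMap R S)).hilbertSamuel = I.hilbertSamuel := by
      ext n
      rw [Ideal.hilbertSamuel, Ideal.hilbertSamuel, hlenS]
    rw [this, List.length_map]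
    exact (hN n hn).2
end
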